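/- arXiv:1503.06650 — 3 statements merged into one kernel-verified Lean document; each statement's English description precedes it below -/
import Mathlib

section
/- Let f̄ : ℝⁿ → ℝⁿ be globally Lipschitz with flow φ, let β > 0, let μ be a finite compactly supported nonnegative Borel measure on ℝⁿ, let a > 0 and x_0, x_T ∈ ℝⁿ, and suppose that for every continuously differentiable v : ℝⁿ → ℝ one has a·v(x_T) = v(x_0) + ∫_{ℝⁿ} ( ∇v(x)·f̄(x) − β v(x) ) dμ(x). Then there exists τ ≥ 0 such that φ(τ, x_0) = x_T and a·e^{βτ} ≤ 1 (equivalently, a ≤ e^{−βτ}). -/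
open MeasureTheory Set

/-- the hypotheses on the flow -/
structure IsFl {n : ℕ} (f : (Fin n → ℝ) → (Fin n → ℝ)) (K : NNReal)
    (φ : ℝ → (Fin n → ℝ) → (Fin n → ℝ)) : Prop where
  lip : LipschitzWith K f
  zero : ∀ x, φ 0 x = x
  der : ∀ x, ∀ t ∈ Ici (0:ℝ), HasDerivWithinAt (fun s => φ s x) (f (φ t x)) (Ici 0) t

namespace IsFl

variable {n : ℕ} {f : (Fin n → ℝ) → (Fin n → ℝ)} {K : NNReal}
    {φ : ℝ → (Fin n → ℝ) → (Fin n → ℝ)}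

lemma contOn (h : IsFl f K φ) (x : Fin n → ℝ) : ContinuousOn (fun s => φ s x) (Ici 0) :=
  fun t ht => (h.der x t ht).continuousWithinAt

lemma derR (h : IsFl f K φ) (x : Fin n → ℝ) {t : ℝ} (ht : 0 ≤ t) :
    HasDerivWithinAt (fun s => φ s x) (f (φ t x)) (Ici t) t :=
  (h.der x t ht).mono (Ici_subset_Ici.2 ht)

lemma derL (h : IsFl f K φ) (x : Fin n → ℝ) {t : ℝ} (ht : 0 < t) :
    HasDerivWithinAt (fun s => φ s x) (f (φ t x)) (Iic t) t :=
  ((h.der x t ht.le).hasDerivAt (Ici_mem_nhds ht)).hasDerivWithinAt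

lemma contg (h : IsFl f K φ) (x : Fin n → ℝ) : Continuous (fun s => φ (max s 0) x) :=
  (h.contOn x).comp_continuous (by fun_prop) (fun s => le_max_right s 0)

lemma dist_le (h : IsFl f K φ) (x y : Fin n → ℝ) {t : ℝ} (ht : 0 ≤ t) :
    dist (φ t x) (φ t y) ≤ dist x y * Real.exp (K * t) := by
  have := dist_le_of_trajectories_ODE (v := fun _ => f) (K := K) (f := fun s => φ s x)
    (g := fun s => φ s y) (a := 0) (b := t) (δ := dist x y) (fun _ => h.lip)
    ((h.contOn x).mono Icc_subset_Ici_self) (fun s hs => h.derR x hs.1)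
    ((h.contOn y).mono Icc_subset_Ici_self) (fun s hs => h.derR y hs.1)
    (by simp [h.zero]) t ⟨ht, le_rfl⟩
  simpa using this

lemma semi (h : IsFl f K φ) (x : Fin n → ℝ) {s t : ℝ} (hs : 0 ≤ s) (ht : 0 ≤ t) :
    φ (t + s) x = φ t (φ s x) := by
  have := ODE_solution_unique (v := fun _ => f) (K := K) (f := fun u => φ (u + s) x)
    (g := fun u => φ u (φ s x)) (a := 0) (b := t) (fun _ => h.lip)
    ((h.contOn x).comp (by fun_prop) (fun u hu => add_nonneg hu.1 hs))
    (fun u hu => by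
      have h1 := h.derR x (add_nonneg hu.1 hs)
      have h2 : HasDerivWithinAt (fun u : ℝ => u + s) 1 (Ici u) u :=
        ((hasDerivAt_id u).add_const s).hasDerivWithinAt
      have := HasDerivWithinAt.scomp (t' := Ici (u + s)) u h1 h2
        (fun v hv => by simpa using hv)
      simpa [Function.comp_def] using this)
    ((h.contOn _).mono Icc_subset_Ici_self) (fun s hs => h.derR _ hs.1)
    (by simp [h.zero])
  exact this ⟨ht, le_rfl⟩

lemma inj (h : IsFl f K φ) {x y : Fin n → ℝ} {t : ℝ} (ht : 0 ≤ t) (hxy : φ t x = φ t y) :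
    x = y := by
  have := ODE_solution_unique_of_mem_Icc_left (v := fun _ => f) (s := fun _ => univ) (K := K)
    (f := fun u => φ u x)
    (g := fun u => φ u y) (a := 0) (b := t) (fun _ _ => h.lip.lipschitzOnWith)
    ((h.contOn _).mono Icc_subset_Ici_self) (fun s hs => h.derL _ hs.1) (fun _ _ => mem_univ _)
    ((h.contOn _).mono Icc_subset_Ici_self) (fun s hs => h.derL _ hs.1) (fun _ _ => mem_univ _)
    hxy
  simpa [h.zero] using this ⟨le_rfl, ht⟩

/-- points near `x` stay near `x` for short times -/
lemma near (h : IsFl f K φ) (x : Fin n → ℝ) {ρ : ℝ} (hρ : 0 < ρ) :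
    ∃ r > 0, ∀ y ∈ Metric.ball x r, ∀ s, 0 ≤ s → s ≤ r → φ s y ∈ Metric.ball x ρ := by
  have hc := (h.contg x).tendsto 0
  simp only [max_self, h.zero] at hc
  obtain ⟨d, hd, hd'⟩ := Metric.eventually_nhds_iff.1 (hc.eventually (Metric.ball_mem_nhds x (half_pos hρ)))
  have he : 0 < Real.exp K := Real.exp_pos _
  refine ⟨min (d/2) (min 1 (ρ / 2 / Real.exp K)), by positivity, fun y hy s hs hsr => ?_⟩
  have hs1 : s ≤ 1 := hsr.trans ((min_le_right _ _).trans (min_le_left _ _))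
  have hsd : s < d := lt_of_le_of_lt (hsr.trans (min_le_left _ _)) (by linarith)
  have h1 : dist (φ s x) x < ρ / 2 := by
    have := @hd' s (by simpa [abs_of_nonneg hs] using hsd)
    simpa [max_eq_left hs] using this
  have h2 := h.dist_le y x hs
  have h3 : Real.exp (K * s) ≤ Real.exp K :=
    Real.exp_le_exp.2 (mul_le_of_le_one_right K.2 hs1)
  have h4 : dist y x < ρ / 2 / Real.exp K :=
    lt_of_lt_of_le (Metric.mem_ball.1 hy) ((min_le_right _ _).trans (min_le_right _ _))
  rw [lt_div_iff₀ he] at h4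
  have h5 := mul_le_mul_of_nonneg_left h3 (dist_nonneg (x := y) (y := x))
  have := dist_triangle (φ s y) (φ s x) x
  rw [Metric.mem_ball]
  linarith

lemma strict (h : IsFl f K φ) {v D : (Fin n → ℝ) → ℝ} {L : NNReal} (hv : LipschitzWith L v)
    (hD : Continuous D)
    (hvD : ∀ x, ∀ s, 0 ≤ s → HasDerivWithinAt (fun s => v (φ s x)) (D (φ s x)) (Ici s) s)
    (x : Fin n → ℝ) {η : ℝ} (hη : 0 < η) :
    ∃ r > 0, ∀ y ∈ Metric.ball x r, ∀ s, 0 ≤ s → s ≤ r →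
      |v (y + s • f x) - v y - s * D x| ≤ η * s := by
  set η' := η / (L + 1) with hη'
  have hL : (0:ℝ) ≤ L := L.2
  have hη0 : 0 < η' := by positivity
  obtain ⟨ρ, hρ, hρ'⟩ := Metric.eventually_nhds_iff.1
    ((hD.tendsto x |>.eventually (Metric.ball_mem_nhds _ hη0)).and
      (h.lip.continuous.tendsto x |>.eventually (Metric.ball_mem_nhds _ hη0)))
  obtain ⟨r, hr, H⟩ := h.near x hρ
  refine ⟨r, hr, fun y hy s hs hsr => ?_⟩
  have hb : ∀ u ∈ Ico 0 s, dist (φ u y) x < ρ := fun u hu => H y hy u hu.1 (hu.2.le.trans hsr)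
  have e1 : ‖(φ s y - s • f x) - (φ 0 y - (0:ℝ) • f x)‖ ≤ η' * (s - 0) :=
    norm_image_sub_le_of_norm_deriv_right_le_segment (f := fun u => φ u y - u • f x)
      (f' := fun u => f (φ u y) - f x)
      (((h.contOn y).mono Icc_subset_Ici_self).sub (by fun_prop))
      (fun u hu => (h.derR y hu.1).sub
        (by simpa using ((hasDerivAt_id u).smul_const (f x)).hasDerivWithinAt))
      (fun u hu => by
        have := (hρ' (hb u hu)).2
        change dist _ _ < _ at this
        rw [dist_eq_norm] at this
        exact this.le) s ⟨hs, le_rfl⟩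
  have hcv : ContinuousOn (fun u => v (φ u y)) (Icc 0 s) :=
    hv.continuous.comp_continuousOn ((h.contOn y).mono Icc_subset_Ici_self)
  have e2 : ‖(v (φ s y) - s * D x) - (v (φ 0 y) - (0:ℝ) * D x)‖ ≤ η' * (s - 0) :=
    norm_image_sub_le_of_norm_deriv_right_le_segment (f := fun u => v (φ u y) - u * D x)
      (f' := fun u => D (φ u y) - D x)
      (hcv.sub (by fun_prop))
      (fun u hu => (hvD y u hu.1).sub
        (by simpa using ((hasDerivAt_id u).mul_const (D x)).hasDerivWithinAt))
      (fun u hu => by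
        have := (hρ' (hb u hu)).1
        change dist _ _ < _ at this
        rw [dist_eq_norm] at this
        exact this.le) s ⟨hs, le_rfl⟩
  have e3 := hv.dist_le_mul (y + s • f x) (φ s y)
  rw [dist_comm (y + s • f x), dist_eq_norm (φ s y), Real.dist_eq] at e3
  simp only [h.zero, zero_smul, sub_zero, zero_mul, Real.norm_eq_abs] at e1 e2
  have e4 : φ s y - (y + s • f x) = φ s y - s • f x - y := by abel
  rw [e4] at e3
  have e5 : (L:ℝ) * ‖φ s y - s • f x - y‖ ≤ L * (η' * s) := mul_le_mul_of_nonneg_left e1 hL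
  have e6 : η' * s + L * (η' * s) = η * s := by rw [hη']; field_simp; ring
  have e7 : v (y + s • f x) - v y - s * D x
      = (v (y + s • f x) - v (φ s y)) + (v (φ s y) - s * D x - v y) := by ring
  rw [e7]
  refine (abs_add_le _ _).trans ?_
  linarith

end IsFl

section moll
variable {n : ℕ}

/-- mollification -/
noncomputable def moll (b : ContDiffBump (0 : Fin n → ℝ)) (v : (Fin n → ℝ) → ℝ) :
    (Fin n → ℝ) → ℝ :=
  convolution (b.normed volume) v (ContinuousLinearMap.lsmul ℝ ℝ) volume

lemma moll_contDiff (b : ContDiffBump (0 : Fin n → ℝ)) {v : (Fin n → ℝ) → ℝ}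
    (hv : Continuous v) : ContDiff ℝ 1 (moll b v) := by
  have := HasCompactSupport.contDiff_convolution_left (n := 1) (ContinuousLinearMap.lsmul ℝ ℝ)
    (b.hasCompactSupport_normed (μ := volume)) (b.contDiff_normed (μ := volume)) (hv.locallyIntegrable (μ := volume))
  exact_mod_cast this

lemma moll_bound (b : ContDiffBump (0 : Fin n → ℝ)) {v : (Fin n → ℝ) → ℝ}
    (hv : Continuous v) (x x' : Fin n → ℝ) (c C : ℝ)
    (H : ∀ t ∈ Metric.ball (0 : Fin n → ℝ) b.rOut, |v (x' - t) - v (x - t) - c| ≤ C) :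
    |moll b v x' - moll b v x - c| ≤ C := by
  have hi : ∀ z, Integrable (fun t => b.normed volume t * v (z - t)) := fun z =>
    (HasCompactSupport.convolutionExists_left (ContinuousLinearMap.lsmul ℝ ℝ)
      (b.hasCompactSupport_normed (μ := volume)) (b.continuous_normed) hv.locallyIntegrable) z
  have h1 : moll b v x' - moll b v x - c
      = ∫ t, b.normed volume t * (v (x' - t) - v (x - t) - c) := by
    have : ∀ z, moll b v z = ∫ t, b.normed volume t * v (z - t) := fun z => rfl
    have e : ∀ t, b.normed volume t * (v (x' - t) - v (x - t) - c)
        = b.normed volume t * v (x' - t) - b.normed volume t * v (x - t)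
          - b.normed volume t * c := fun t => by ring
    simp_rw [e]
    rw [this, this, integral_sub, integral_sub (hi _) (hi _), integral_mul_const,
      b.integral_normed, one_mul]
    · exact (hi _).sub (hi _)
    · exact b.integrable_normed.mul_const c
  rw [h1, ← Real.norm_eq_abs]
  have h2 : (∫ t, b.normed volume t * C) = C := by
    rw [integral_mul_const, b.integral_normed, one_mul]
  rw [← h2]
  refine norm_integral_le_of_norm_le (b.integrable_normed.mul_const C) (ae_of_all _ fun t => ?_)
  rw [norm_mul, Real.norm_of_nonneg (b.nonneg_normed t)]
  by_cases ht : t ∈ Metric.ball (0 : Fin n → ℝ) b.rOut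
  · exact mul_le_mul_of_nonneg_left (H t ht) (b.nonneg_normed t)
  · rw [← b.support_normed_eq (μ := volume), Function.notMem_support] at ht
    simp [ht]

lemma moll_lip (b : ContDiffBump (0 : Fin n → ℝ)) {v : (Fin n → ℝ) → ℝ} {L : NNReal}
    (hv : LipschitzWith L v) : LipschitzWith L (moll b v) := by
  refine LipschitzWith.of_dist_le_mul fun x y => ?_
  have := moll_bound b hv.continuous y x 0 (L * dist x y) (fun t _ => by
    have := hv.dist_le_mul (x - t) (y - t)
    simpa [Real.dist_eq] using this)
  simpa [Real.dist_eq] using this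

lemma moll_close (b : ContDiffBump (0 : Fin n → ℝ)) {v : (Fin n → ℝ) → ℝ} {L : NNReal}
    (hv : LipschitzWith L v) (x : Fin n → ℝ) : dist (moll b v x) (v x) ≤ L * b.rOut := by
  refine ContDiffBump.dist_normed_convolution_le hv.continuous.aestronglyMeasurable
    fun y hy => (hv.dist_le_mul y x).trans ?_
  exact mul_le_mul_of_nonneg_left (Metric.mem_ball.1 hy).le L.2

lemma moll_fderiv (b : ContDiffBump (0 : Fin n → ℝ)) {v : (Fin n → ℝ) → ℝ}
    (hv : Continuous v) (x w : Fin n → ℝ) {d η r : ℝ} (hr : 0 < r) (hbr : b.rOut ≤ r)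
    (H : ∀ y ∈ Metric.ball x r, ∀ s, 0 ≤ s → s ≤ r → |v (y + s • w) - v y - s * d| ≤ η * s) :
    |fderiv ℝ (moll b v) x w - d| ≤ η := by
  have hd : HasFDerivAt (moll b v) (fderiv ℝ (moll b v) x) x :=
    ((moll_contDiff b hv).differentiable (by norm_num) x).hasFDerivAt
  have hl : HasDerivAt (fun s : ℝ => moll b v (x + s • w)) (fderiv ℝ (moll b v) x w) 0 := by
    have := hd.hasLineDerivAt w
    exact this
  have hs := hl.tendsto_slope_zero_right
  have hs' := (hs.sub_const d).abs
  refine le_of_tendsto hs' ?_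
  filter_upwards [Ioc_mem_nhdsGT hr] with s hsr
  have hm := moll_bound b hv x (x + s • w) (s * d) (η * s) (fun t ht => by
    have := H (x - t) (by
      have h0 : ‖t‖ < b.rOut := by simpa using ht
      simpa [Metric.mem_ball, dist_eq_norm] using h0.trans_le hbr) s hsr.1.le hsr.2
    rwa [show x + s • w - t = x - t + s • w by abel])
  have hs0 : 0 < s := hsr.1
  have : s⁻¹ • (moll b v (x + (0 + s) • w) - moll b v (x + (0:ℝ) • w)) - d
      = s⁻¹ * (moll b v (x + s • w) - moll b v x - s * d) := by
    simp only [zero_add, zero_smul, add_zero, smul_eq_mul]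
    field_simp
  rw [this, abs_mul, abs_of_pos (inv_pos.2 hs0), inv_mul_le_iff₀ hs0]
  linarith

end moll

/-- The Liouville identity extends to Lipschitz functions differentiable along the flow. -/
lemma liouville_ext {n : ℕ} {f : (Fin n → ℝ) → (Fin n → ℝ)} {K : NNReal}
    {φ : ℝ → (Fin n → ℝ) → (Fin n → ℝ)} (h : IsFl f K φ) (β : ℝ)
    (μ : Measure (Fin n → ℝ)) [IsFiniteMeasure μ]
    (hμc : ∃ K' : Set (Fin n → ℝ), IsCompact K' ∧ μ K'ᶜ = 0)
    (a : ℝ) (x₀ xT : Fin n → ℝ)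
    (hLiouville : ∀ v : (Fin n → ℝ) → ℝ, ContDiff ℝ 1 v →
      a * v xT = v x₀ + ∫ x, (fderiv ℝ v x (f x) - β * v x) ∂μ)
    {v D : (Fin n → ℝ) → ℝ} {L : NNReal} (hv : LipschitzWith L v)
    (hD : Continuous D)
    (hvD : ∀ x, ∀ s, 0 ≤ s → HasDerivWithinAt (fun s => v (φ s x)) (D (φ s x)) (Ici s) s) :
    a * v xT = v x₀ + ∫ x, (D x - β * v x) ∂μ := by
  let b : ℕ → ContDiffBump (0 : Fin n → ℝ) := fun k =>
    ⟨1 / ((k:ℝ) + 1) / 2, 1 / ((k:ℝ) + 1), by positivity, half_lt_self (by positivity)⟩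
  have hb0 : Filter.Tendsto (fun k => (b k).rOut) Filter.atTop (nhds 0) :=
    tendsto_one_div_add_atTop_nhds_zero_nat
  have hb1 : ∀ k, (b k).rOut ≤ 1 := fun k => by
    change 1 / ((k:ℝ) + 1) ≤ 1
    rw [div_le_one (by positivity)]
    have : (0:ℝ) ≤ k := Nat.cast_nonneg k
    linarith
  have hlim : ∀ x, Filter.Tendsto (fun k => moll (b k) v x) Filter.atTop (nhds (v x)) := fun x => by
    rw [tendsto_iff_dist_tendsto_zero]
    refine squeeze_zero (fun _ => dist_nonneg) (fun k => moll_close (b k) hv x) ?_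
    simpa using hb0.const_mul (L:ℝ)
  have hlim2 : ∀ x, Filter.Tendsto (fun k => fderiv ℝ (moll (b k) v) x (f x)) Filter.atTop
      (nhds (D x)) := fun x => by
    rw [Metric.tendsto_nhds]
    intro ε hε
    obtain ⟨r, hr, H⟩ := h.strict hv hD hvD x (half_pos hε)
    filter_upwards [hb0.eventually (Iio_mem_nhds hr)] with k hk
    rw [Real.dist_eq]
    exact (moll_fderiv (b k) hv.continuous x (f x) hr (le_of_lt hk) H).trans_lt (half_lt_self hε)
  obtain ⟨K', hK', hμK⟩ := hμc
  have hint : ∀ g : (Fin n → ℝ) → ℝ, Continuous g → Integrable g μ := fun g hg => by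
    have h1 : IntegrableOn g K' μ := hg.continuousOn.integrableOn_compact hK'
    rw [IntegrableOn, Measure.restrict_eq_self_of_ae_mem] at h1
    · exact h1
    · rwa [ae_iff]
  have hdc : Filter.Tendsto
      (fun k => ∫ x, (fderiv ℝ (moll (b k) v) x (f x) - β * moll (b k) v x) ∂μ) Filter.atTop
      (nhds (∫ x, (D x - β * v x) ∂μ)) := by
    refine tendsto_integral_of_dominated_convergence
      (fun x => L * ‖f x‖ + |β| * (|v x| + L)) (fun k => ?_) ?_ (fun k => ae_of_all _ fun x => ?_)
      (ae_of_all _ fun x => (hlim2 x).sub ((hlim x).const_mul β))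
    · have c1 := (moll_contDiff (b k) hv.continuous).continuous_fderiv (by norm_num)
      exact ((c1.clm_apply h.lip.continuous).sub
        ((moll_contDiff (b k) hv.continuous).continuous.const_mul β)).aestronglyMeasurable
    · refine hint _ ?_
      have := h.lip.continuous
      have := hv.continuous
      fun_prop
    · refine (norm_sub_le _ _).trans (add_le_add ?_ ?_)
      · refine ((fderiv ℝ (moll (b k) v) x).le_opNorm _).trans ?_
        exact mul_le_mul_of_nonneg_right (norm_fderiv_le_of_lipschitz ℝ (moll_lip (b k) hv))
          (norm_nonneg _)
      · rw [norm_mul, Real.norm_eq_abs, Real.norm_eq_abs]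
        refine mul_le_mul_of_nonneg_left ?_ (abs_nonneg _)
        have h1 := moll_close (b k) hv x
        rw [Real.dist_eq] at h1
        have h2 : (L:ℝ) * (b k).rOut ≤ L := mul_le_of_le_one_right L.2 (hb1 k)
        have h3 := abs_add_le (v x) (moll (b k) v x - v x)
        rw [add_sub_cancel] at h3
        linarith
  refine tendsto_nhds_unique ((hlim xT).const_mul a) ?_
  refine ((hlim x₀).add hdc).congr fun k => ?_
  exact (hLiouville _ (moll_contDiff (b k) hv.continuous)).symm

lemma integrable_of_cpt {n : ℕ} (μ : Measure (Fin n → ℝ)) [IsFiniteMeasure μ]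
    (hμc : ∃ K' : Set (Fin n → ℝ), IsCompact K' ∧ μ K'ᶜ = 0)
    (g : (Fin n → ℝ) → ℝ) (hg : Continuous g) : Integrable g μ := by
  obtain ⟨K', hK', hμK⟩ := hμc
  have h1 : IntegrableOn g K' μ := hg.continuousOn.integrableOn_compact hK'
  rw [IntegrableOn, Measure.restrict_eq_self_of_ae_mem] at h1
  · exact h1
  · rwa [ae_iff]

/-- finite horizon discounted resolvent -/
noncomputable def vT {n : ℕ} (φ : ℝ → (Fin n → ℝ) → (Fin n → ℝ)) (β : ℝ)
    (g : (Fin n → ℝ) → ℝ) (T : ℝ) (x : Fin n → ℝ) : ℝ :=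
  ∫ t in (0:ℝ)..T, Real.exp (-β * t) * g (φ (max t 0) x)

namespace IsFl

variable {n : ℕ} {f : (Fin n → ℝ) → (Fin n → ℝ)} {K : NNReal}
    {φ : ℝ → (Fin n → ℝ) → (Fin n → ℝ)}

lemma contx (h : IsFl f K φ) {t : ℝ} (ht : 0 ≤ t) : Continuous (φ t) := by
  have : LipschitzWith (Real.exp (K * t)).toNNReal (φ t) :=
    LipschitzWith.of_dist_le_mul fun x y => by
      rw [Real.coe_toNNReal _ (Real.exp_pos _).le, mul_comm]
      exact h.dist_le x y ht
  exact this.continuous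

lemma cont_int (h : IsFl f K φ) (β : ℝ) {g : (Fin n → ℝ) → ℝ} (hg : Continuous g)
    (x : Fin n → ℝ) : Continuous fun t => Real.exp (-β * t) * g (φ (max t 0) x) := by
  exact Continuous.mul (by fun_prop) (hg.comp (h.contg x))

lemma vT_lip (h : IsFl f K φ) {β : ℝ} (hβ : 0 < β) {g : (Fin n → ℝ) → ℝ} {C : NNReal}
    (hg : LipschitzWith C g) {T : ℝ} (hT : 0 ≤ T) :
    ∃ L : NNReal, LipschitzWith L (vT φ β g T) := by
  refine ⟨(C * Real.exp (K * T) * T).toNNReal, LipschitzWith.of_dist_le_mul fun x y => ?_⟩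
  rw [Real.coe_toNNReal _ (by positivity), Real.dist_eq, vT, vT, ← intervalIntegral.integral_sub
    ((h.cont_int β hg.continuous x).intervalIntegrable _ _)
    ((h.cont_int β hg.continuous y).intervalIntegrable _ _), ← Real.norm_eq_abs]
  refine (intervalIntegral.norm_integral_le_of_norm_le_const
    (C := C * Real.exp (K * T) * dist x y) fun t ht => ?_).trans (le_of_eq ?_)
  · rw [uIoc_of_le hT] at ht
    rw [← mul_sub, norm_mul, Real.norm_of_nonneg (Real.exp_pos _).le, max_eq_left ht.1.le]
    have h1 : Real.exp (-β * t) ≤ 1 := by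
      rw [Real.exp_le_one_iff]; nlinarith [ht.1]
    have h2 : ‖g (φ t x) - g (φ t y)‖ ≤ C * dist (φ t x) (φ t y) := by
      rw [← dist_eq_norm]; exact hg.dist_le_mul _ _
    have h3 := h.dist_le x y ht.1.le
    have h4 : Real.exp (K * t) ≤ Real.exp (K * T) :=
      Real.exp_le_exp.2 (mul_le_mul_of_nonneg_left ht.2 K.2)
    calc _ ≤ 1 * (C * (dist x y * Real.exp (K * T))) := by
          refine mul_le_mul h1 (h2.trans ?_) (norm_nonneg _) zero_le_one
          refine mul_le_mul_of_nonneg_left (h3.trans ?_) C.2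
          exact mul_le_mul_of_nonneg_left h4 dist_nonneg
      _ = _ := by ring
  · rw [sub_zero, abs_of_nonneg hT]; ring

lemma vT_flow (h : IsFl f K φ) (β : ℝ) (g : (Fin n → ℝ) → ℝ)
    {T : ℝ} (hT : 0 ≤ T) (x : Fin n → ℝ) {s : ℝ} (hs : 0 ≤ s) :
    vT φ β g T (φ s x) =
      Real.exp (β * s) * ∫ u in s..(T + s), Real.exp (-β * u) * g (φ (max u 0) x) := by
  have h1 := intervalIntegral.integral_comp_add_right (a := 0) (b := T)
    (fun u => Real.exp (-β * u) * g (φ (max u 0) x)) s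
  rw [zero_add] at h1
  rw [← h1, ← intervalIntegral.integral_const_mul, vT]
  refine intervalIntegral.integral_congr fun t ht => ?_
  rw [uIcc_of_le hT] at ht
  rw [max_eq_left ht.1, max_eq_left (add_nonneg ht.1 hs), h.semi x hs ht.1, ← mul_assoc,
    ← Real.exp_add]
  congr 2
  ring

lemma vT_der (h : IsFl f K φ) (β : ℝ) {g : (Fin n → ℝ) → ℝ} (hg : Continuous g)
    {T : ℝ} (hT : 0 ≤ T) (x : Fin n → ℝ) {s : ℝ} (hs : 0 ≤ s) :
    HasDerivWithinAt (fun s => vT φ β g T (φ s x))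
      (β * vT φ β g T (φ s x) - g (φ s x) + Real.exp (-β * T) * g (φ T (φ s x))) (Ici s) s := by
  set F : ℝ → ℝ := fun u => Real.exp (-β * u) * g (φ (max u 0) x) with hF
  have hFc : Continuous F := h.cont_int β hg x
  have d1 : HasDerivAt (fun s => ∫ u in (0:ℝ)..s, F u) (F s) s :=
    (hFc.integral_hasStrictDerivAt 0 s).hasDerivAt
  have d2 : HasDerivAt (fun s => ∫ u in (0:ℝ)..(T + s), F u) (F (T + s)) s :=
    HasDerivAt.comp_const_add T s (hFc.integral_hasStrictDerivAt 0 (T + s)).hasDerivAt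
  have d3 : HasDerivAt (fun s => Real.exp (β * s)) (Real.exp (β * s) * β) s := by
    simpa using ((hasDerivAt_id s).const_mul β).exp
  have d4 := d3.mul (d2.sub d1)
  have key : ∀ s, 0 ≤ s → vT φ β g T (φ s x) =
      Real.exp (β * s) * ((∫ u in (0:ℝ)..(T + s), F u) - ∫ u in (0:ℝ)..s, F u) := fun s hs => by
    rw [h.vT_flow β g hT x hs, intervalIntegral.integral_interval_sub_left
      (hFc.intervalIntegrable _ _) (hFc.intervalIntegrable _ _)]
  refine (d4.hasDerivWithinAt (s := Ici s)).congr_of_eventuallyEq_of_mem ?_ self_mem_Ici |>.congr_deriv ?_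
  · filter_upwards [self_mem_nhdsWithin] with u hu
    exact key u (hs.trans hu)
  · rw [key s hs]
    simp only [hF, Pi.sub_apply]
    rw [max_eq_left hs, max_eq_left (add_nonneg hT hs), h.semi x hs hT]
    have e1 : Real.exp (β * s) * Real.exp (-β * s) = 1 := by
      rw [← Real.exp_add]; simp
    have e2 : Real.exp (β * s) * Real.exp (-β * (T + s)) = Real.exp (-β * T) := by
      rw [← Real.exp_add]; congr 1; ring
    rw [← e2]
    linear_combination (-g (φ s x)) * e1

end IsFl

section main
variable {n : ℕ} {f : (Fin n → ℝ) → (Fin n → ℝ)} {K : NNReal}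
    {φ : ℝ → (Fin n → ℝ) → (Fin n → ℝ)}

lemma res_ineq (h : IsFl f K φ) {β : ℝ} (hβ : 0 < β)
    (μ : Measure (Fin n → ℝ)) [IsFiniteMeasure μ]
    (hμc : ∃ K' : Set (Fin n → ℝ), IsCompact K' ∧ μ K'ᶜ = 0)
    (a : ℝ) (x₀ xT : Fin n → ℝ)
    (hLiouville : ∀ v : (Fin n → ℝ) → ℝ, ContDiff ℝ 1 v →
      a * v xT = v x₀ + ∫ x, (fderiv ℝ v x (f x) - β * v x) ∂μ)
    {g : (Fin n → ℝ) → ℝ} {C : NNReal} (hg : LipschitzWith C g) (hg0 : ∀ x, 0 ≤ g x)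
    (hg1 : ∀ x, g x ≤ 1) {T : ℝ} (hT : 0 ≤ T) :
    a * vT φ β g T xT ≤ vT φ β g T x₀ + Real.exp (-β * T) * μ.real univ := by
  obtain ⟨L, hL⟩ := h.vT_lip hβ hg hT
  have hgc := hg.continuous
  have hvc := hL.continuous
  have hTc := h.contx hT
  rw [liouville_ext h β μ hμc a x₀ xT hLiouville (v := vT φ β g T)
    (D := fun z => β * vT φ β g T z - g z + Real.exp (-β * T) * g (φ T z)) hL (by fun_prop)
    (fun x s hs => h.vT_der β hgc hT x hs)]
  gcongr
  calc _ ≤ ∫ x, Real.exp (-β * T) ∂μ := by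
        refine integral_mono (integrable_of_cpt μ hμc _ (by fun_prop)) (integrable_const _)
          fun x => ?_
        have := mul_le_mul_of_nonneg_left (hg1 (φ T x)) (Real.exp_pos (-β * T)).le
        have := hg0 x
        simp only
        linarith
    _ = _ := by rw [integral_const, smul_eq_mul, mul_comm]

lemma ind_ineq (h : IsFl f K φ) {β : ℝ} (hβ : 0 < β)
    (μ : Measure (Fin n → ℝ)) [IsFiniteMeasure μ]
    (hμc : ∃ K' : Set (Fin n → ℝ), IsCompact K' ∧ μ K'ᶜ = 0)
    (a : ℝ) (x₀ xT : Fin n → ℝ)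
    (hLiouville : ∀ v : (Fin n → ℝ) → ℝ, ContDiff ℝ 1 v →
      a * v xT = v x₀ + ∫ x, (fderiv ℝ v x (f x) - β * v x) ∂μ)
    {A : Set (Fin n → ℝ)} (hA : IsClosed A) {T : ℝ} (hT : 0 ≤ T) :
    a * vT φ β (A.indicator 1) T xT
      ≤ vT φ β (A.indicator 1) T x₀ + Real.exp (-β * T) * μ.real univ := by
  have hp : ∀ k : ℕ, (0:ℝ) < 1 / ((k:ℝ) + 1) := fun k => by positivity
  let g : ℕ → (Fin n → ℝ) → ℝ := fun k x => (thickenedIndicator (hp k) A x : ℝ)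
  have hgl : ∀ k, LipschitzWith _ (g k) := fun k =>
    NNReal.isometry_coe.lipschitz.comp (lipschitzWith_thickenedIndicator (hp k) A)
  have hg0 : ∀ k x, 0 ≤ g k x := fun k x => NNReal.coe_nonneg _
  have hg1 : ∀ k x, g k x ≤ 1 := fun k x => by
    exact NNReal.coe_le_coe.2 (thickenedIndicator_le_one (hp k) A x)
  have hgt : ∀ x, Filter.Tendsto (fun k => g k x) Filter.atTop (nhds (A.indicator 1 x)) := by
    intro x
    have h1 := thickenedIndicator_tendsto_indicator_closure hp
      tendsto_one_div_add_atTop_nhds_zero_nat A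
    rw [hA.closure_eq, tendsto_pi_nhds] at h1
    have h2 := (NNReal.continuous_coe.tendsto _).comp (h1 x)
    have h3 : ((A.indicator (fun _ => (1:NNReal)) x : NNReal) : ℝ) = A.indicator 1 x := by
      by_cases hx : x ∈ A <;> simp [hx]
    rw [h3] at h2
    exact h2
  have hlim : ∀ x, Filter.Tendsto (fun k => vT φ β (g k) T x) Filter.atTop
      (nhds (vT φ β (A.indicator 1) T x)) := fun x => by
    refine intervalIntegral.tendsto_integral_filter_of_dominated_convergence
      (fun t => Real.exp (-β * t)) (Filter.Eventually.of_forall fun k => ?_)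
      (Filter.Eventually.of_forall fun k => ae_of_all _ fun t _ => ?_)
      (Continuous.intervalIntegrable (by fun_prop) _ _)
      (ae_of_all _ fun t _ => (hgt _).const_mul _)
    · exact (h.cont_int β (hgl k).continuous x).aestronglyMeasurable
    · rw [norm_mul, Real.norm_of_nonneg (Real.exp_pos _).le, Real.norm_of_nonneg (hg0 _ _)]
      exact mul_le_of_le_one_right (Real.exp_pos _).le (hg1 _ _)
  exact le_of_tendsto_of_tendsto' ((hlim xT).const_mul a) ((hlim x₀).add_const _)
    fun k => res_ineq h hβ μ hμc a x₀ xT hLiouville (hgl k) (hg0 k) (hg1 k) hT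

lemma ind_integrable (h : IsFl f K φ) (β : ℝ) {A : Set (Fin n → ℝ)} (hA : IsClosed A)
    (x : Fin n → ℝ) (p q : ℝ) :
    IntervalIntegrable (fun t => Real.exp (-β * t) * A.indicator 1 (φ (max t 0) x)) volume p q := by
  have h1 : IntervalIntegrable (fun t => Real.exp (-β * t)) volume p q :=
    Continuous.intervalIntegrable (by fun_prop) _ _
  have hm : Measurable (fun t => Real.exp (-β * t) * A.indicator (1 : (Fin n → ℝ) → ℝ) (φ (max t 0) x)) := by
    refine Measurable.mul (by fun_prop) ?_
    exact (measurable_one.indicator hA.measurableSet).comp (h.contg x).measurable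
  refine h1.mono_fun hm.aestronglyMeasurable (ae_of_all _ fun t => ?_)
  change ‖_ * _‖ ≤ ‖_‖
  rw [norm_mul]
  refine mul_le_of_le_one_right (norm_nonneg _) ?_
  by_cases hx : φ (max t 0) x ∈ A <;> simp [hx]

lemma ind_nonneg (β : ℝ) (A : Set (Fin n → ℝ)) (x : Fin n → ℝ) (t : ℝ) :
    0 ≤ Real.exp (-β * t) * A.indicator (1 : (Fin n → ℝ) → ℝ) (φ (max t 0) x) :=
  mul_nonneg (Real.exp_pos _).le (indicator_nonneg (fun _ _ => zero_le_one) _)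

end main

/-- Two-Diracs case of the superposition theorem: if `(δ_{x₀}, a·δ_{x_T}, μ)` solve the
discounted Liouville equation, then `x_T` lies on the forward orbit of `x₀`, reached at
some time `τ ≥ 0` with `a e^{βτ} ≤ 1`. -/
theorem liouville_two_diracs {n : ℕ}
    (f : (Fin n → ℝ) → (Fin n → ℝ)) (K : NNReal) (hf : LipschitzWith K f)
    (φ : ℝ → (Fin n → ℝ) → (Fin n → ℝ))
    (hφ0 : ∀ x, φ 0 x = x)
    (hφ : ∀ x, ∀ t ∈ Ici (0:ℝ), HasDerivWithinAt (fun s => φ s x) (f (φ t x)) (Ici 0) t)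
    (β : ℝ) (hβ : 0 < β)
    (μ : Measure (Fin n → ℝ)) [IsFiniteMeasure μ]
    (hμc : ∃ K' : Set (Fin n → ℝ), IsCompact K' ∧ μ K'ᶜ = 0)
    (a : ℝ) (ha : 0 < a) (x₀ xT : Fin n → ℝ)
    (hLiouville : ∀ v : (Fin n → ℝ) → ℝ, ContDiff ℝ 1 v →
      a * v xT = v x₀ + ∫ x, (fderiv ℝ v x (f x) - β * v x) ∂μ) :
    ∃ τ : ℝ, 0 ≤ τ ∧ φ τ x₀ = xT ∧ a * Real.exp (β * τ) ≤ 1 := by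
  have h : IsFl f K φ := ⟨hf, hφ0, hφ⟩
  by_cases hne : x₀ = xT
  · refine ⟨0, le_rfl, by rw [hφ0, hne], ?_⟩
    have h1 := hLiouville (fun _ => 1) contDiff_const
    simp at h1
    have : 0 ≤ μ.real univ * β := by positivity
    simp
    linarith
  -- a short time during which the orbit of `xT` avoids `x₀`
  obtain ⟨ε, hε, hav⟩ : ∃ ε > 0, ∀ r, 0 ≤ r → r ≤ ε → φ r xT ≠ x₀ := by
    obtain ⟨r, hr, H⟩ := h.near xT (dist_pos.2 hne)
    refine ⟨r, hr, fun s hs hsr he => ?_⟩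
    have := H xT (Metric.mem_ball_self hr) s hs hsr
    rw [he, Metric.mem_ball] at this
    exact lt_irrefl _ this
  set A : Set (Fin n → ℝ) := (fun s => φ (max s 0) xT) '' Icc 0 ε with hAdef
  have hA : IsClosed A := (isCompact_Icc.image (h.contg xT)).isClosed
  have key : ∀ s, 0 ≤ s → φ s x₀ ∈ A → ∃ u, 0 ≤ u ∧ u ≤ s ∧ φ u x₀ = xT := by
    rintro s hs ⟨t, ht, hte⟩
    simp only [max_eq_left ht.1] at hte
    rcases lt_or_ge s t with hst | hst
    · exfalso
      have e := h.semi xT (s := t - s) (t := s) (by linarith) hs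
      rw [add_sub_cancel, hte] at e
      exact hav (t - s) (by linarith) (by linarith [ht.2]) (h.inj hs e).symm
    · refine ⟨s - t, by linarith, by linarith [ht.1], ?_⟩
      have e := h.semi x₀ (s := s - t) (t := t) (by linarith) ht.1
      rw [add_sub_cancel, ← hte] at e
      exact (h.inj ht.1 e).symm
  set c : ℝ := ∫ t in (0:ℝ)..ε, Real.exp (-β * t) with hc
  have hcpos : 0 < c := intervalIntegral.intervalIntegral_pos_of_pos
    (Continuous.intervalIntegrable (by fun_prop) _ _) (fun t => Real.exp_pos _) hε
  have hRT : ∀ T, ε ≤ T → c ≤ vT φ β (A.indicator 1) T xT := fun T hT => by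
    have e1 : c = ∫ t in (0:ℝ)..ε, Real.exp (-β * t) * A.indicator 1 (φ (max t 0) xT) := by
      refine intervalIntegral.integral_congr fun t ht => ?_
      rw [uIcc_of_le hε.le] at ht
      have : φ (max t 0) xT ∈ A := ⟨t, ht, rfl⟩
      simp [this]
    rw [e1]
    exact intervalIntegral.integral_mono_interval le_rfl hε.le hT
      (ae_of_all _ fun t => ind_nonneg β A xT t) (ind_integrable h β hA xT 0 T)
  have hfin : ∀ κ T₀ : ℝ, (∀ T, T₀ ≤ T → 0 ≤ T →
      vT φ β (A.indicator 1) T x₀ ≤ κ * vT φ β (A.indicator 1) T xT) → a ≤ κ := by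
    intro κ T₀ hκ
    by_contra! hlt
    have hlim : Filter.Tendsto (fun T => Real.exp (-β * T) * μ.real univ) Filter.atTop (nhds 0) := by
      have h1 : Filter.Tendsto (fun T : ℝ => -β * T) Filter.atTop Filter.atBot :=
        Filter.tendsto_id.const_mul_atTop_of_neg (by linarith)
      simpa using (Real.tendsto_exp_atBot.comp h1).mul_const (μ.real univ)
    have : (a - κ) * c ≤ 0 := by
      refine ge_of_tendsto hlim ?_
      filter_upwards [Filter.eventually_ge_atTop T₀, Filter.eventually_ge_atTop ε] with T h1 h2
      have hT0 : 0 ≤ T := hε.le.trans h2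
      have i1 := ind_ineq h hβ μ hμc a x₀ xT hLiouville hA hT0
      have i2 := hκ T h1 hT0
      have i3 := mul_le_mul_of_nonneg_left (hRT T h2) (sub_pos.2 hlt).le
      linarith
    exact absurd this (not_le.2 (mul_pos (sub_pos.2 hlt) hcpos))
  set S : Set ℝ := {s | 0 ≤ s ∧ φ s x₀ = xT} with hS
  have hSne : S.Nonempty := by
    by_contra hemp
    refine absurd (hfin 0 0 fun T _ hT => ?_) (not_le.2 ha)
    rw [zero_mul]
    refine le_of_eq ?_
    rw [vT]
    refine intervalIntegral.integral_zero_ae (ae_of_all _ fun t ht => ?_)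
    rw [uIoc_of_le hT] at ht
    have : φ (max t 0) x₀ ∉ A := fun hm => by
      obtain ⟨u, hu, _, hu'⟩ := key _ (le_max_right t 0) hm
      exact hemp ⟨u, hu, hu'⟩
    simp [this]
  have hSb : BddBelow S := ⟨0, fun s hs => hs.1⟩
  have hSc : IsClosed S := by
    have : S = Ici 0 ∩ (fun s => φ (max s 0) x₀) ⁻¹' {xT} := by
      ext s
      constructor
      · rintro ⟨h1, h2⟩
        exact ⟨h1, by simpa [max_eq_left h1] using h2⟩
      · rintro ⟨h1, h2⟩
        have h1' : 0 ≤ s := h1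
        exact ⟨h1, by simpa [max_eq_left h1'] using h2⟩
    rw [this]
    exact isClosed_Ici.inter (isClosed_singleton.preimage (h.contg x₀))
  have hτ := hSc.csInf_mem hSne hSb
  set τ := sInf S with hτdef
  refine ⟨τ, hτ.1, hτ.2, ?_⟩
  have hmain : a ≤ Real.exp (-β * τ) := by
    refine hfin _ τ fun T hT hT0 => ?_
    have ii := ind_integrable h β hA x₀
    have z : (∫ t in (0:ℝ)..τ, Real.exp (-β * t) * A.indicator 1 (φ (max t 0) x₀)) = 0 := by
      refine intervalIntegral.integral_zero_ae ?_
      filter_upwards [Measure.ae_ne volume τ] with t htne ht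
      rw [uIoc_of_le hτ.1] at ht
      have : φ (max t 0) x₀ ∉ A := fun hm => by
        rw [max_eq_left ht.1.le] at hm
        obtain ⟨u, hu, hut, hu'⟩ := key _ ht.1.le hm
        have : τ ≤ u := csInf_le hSb ⟨hu, hu'⟩
        exact htne (le_antisymm ht.2 (this.trans hut))
      simp [this]
    have e1 : vT φ β (A.indicator 1) T x₀
        = ∫ t in τ..T, Real.exp (-β * t) * A.indicator 1 (φ (max t 0) x₀) := by
      rw [vT, ← intervalIntegral.integral_add_adjacent_intervals (ii 0 τ) (ii τ T), z, zero_add]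
    have e2 : Real.exp (-β * τ) * vT φ β (A.indicator 1) (T - τ) xT
        = ∫ t in τ..T, Real.exp (-β * t) * A.indicator 1 (φ (max t 0) x₀) := by
      rw [← hτ.2, h.vT_flow β _ (sub_nonneg.2 hT) x₀ hτ.1, ← mul_assoc, ← Real.exp_add,
        sub_add_cancel]
      simp
    rw [e1, ← e2]
    refine mul_le_mul_of_nonneg_left ?_ (Real.exp_pos _).le
    exact intervalIntegral.integral_mono_interval le_rfl (sub_nonneg.2 hT) (by linarith [hτ.1])
      (ae_of_all _ fun t => ind_nonneg β A xT t) (ind_integrable h β hA xT 0 T)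
  calc a * Real.exp (β * τ) ≤ Real.exp (-β * τ) * Real.exp (β * τ) :=
        mul_le_mul_of_nonneg_right hmain (Real.exp_pos _).le
    _ = 1 := by rw [← Real.exp_add]; simp
end

section
/- Let f̄ : ℝⁿ → ℝⁿ be globally Lipschitz with flow φ, let β > 0, let μ be a finite compactly supported nonnegative Borel measure on ℝⁿ, let a > 0, x_0, x_T ∈ ℝⁿ, and τ ≥ 0 be such that φ(τ, x_0) = x_T, a·e^{βτ} ≤ 1, and for every continuously differentiable v : ℝⁿ → ℝ one has a·v(x_T) = v(x_0) + ∫_{ℝⁿ} ( ∇v(x)·f̄(x) − β v(x) ) dμ(x). Then for every continuously differentiable compactly supported w : ℝⁿ → ℝ, ∫_{ℝⁿ} w dμ = a e^{βτ} ∫_0^τ e^{−βt} w(φ(t, x_0)) dt + (1 − a e^{βτ}) ∫_0^∞ e^{−βt} w(φ(t, x_0)) dt; that is, μ is the superposition of the discounted occupation measures of two trajectories starting at x_0, one stopped at time τ and one running forever, with weights a e^{βτ} and 1 − a e^{βτ}. -/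
open MeasureTheory Set

open Filter Topology

/-- Existence of a mollification operator at scale `ε`. -/
lemma exists_moll (n : ℕ) (ε : ℝ) (hε : 0 < ε) :
    ∃ A : ((Fin n → ℝ) → ℝ) → (Fin n → ℝ) → ℝ,
      (∀ v, Continuous v → ContDiff ℝ 1 (A v)) ∧
      (∀ v, Continuous v → ∀ x h, A v (x + h) - A v x = A (fun z => v (z + h) - v z) x) ∧
      (∀ v, Continuous v → ∀ x c C, 0 ≤ C → (∀ z ∈ Metric.ball x ε, |v z - c| ≤ C) →
        |A v x - c| ≤ C) := by
  let ρ : ContDiffBump (0 : Fin n → ℝ) := ⟨ε / 2, ε, by positivity, by linarith⟩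
  have hcs : HasCompactSupport (ρ.normed volume) := ρ.hasCompactSupport_normed
  refine ⟨fun v => convolution (ρ.normed volume) v (ContinuousLinearMap.lsmul ℝ ℝ) volume,
    ?_, ?_, ?_⟩
  · intro v hv
    exact hcs.contDiff_convolution_left _ ρ.contDiff_normed hv.locallyIntegrable
  · intro v hv x h
    have hex : ∀ (g : (Fin n → ℝ) → ℝ), Continuous g → ∀ x,
        Integrable (fun t => ρ.normed volume t • g (x - t)) volume := by
      intro g hg x
      apply Continuous.integrable_of_hasCompactSupport
      · exact ρ.continuous_normed.smul (hg.comp (continuous_const.sub continuous_id))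
      · exact hcs.smul_right
    simp only [convolution, ContinuousLinearMap.lsmul_apply]
    rw [← integral_sub (hex v hv _) (hex v hv _)]
    congr 1
    ext t
    rw [← smul_sub]
    congr 3
    abel
  · intro v hv x c C hC hb
    have := dist_convolution_le (μ := (volume : Measure (Fin n → ℝ))) (g := v) (x₀ := x) (z₀ := c)
      (f := ρ.normed volume) hC
      ρ.support_normed_eq.subset ρ.nonneg_normed ρ.integral_normed hv.aestronglyMeasurable
      (fun z hz => by rw [Real.dist_eq]; exact hb z hz)
    rwa [Real.dist_eq] at this

section flow

variable {n : ℕ} {f : (Fin n → ℝ) → (Fin n → ℝ)} {K : NNReal} {φ : ℝ → (Fin n → ℝ) → (Fin n → ℝ)}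

lemma flow_cont
    (hφ : ∀ x, ∀ t ∈ Ici (0:ℝ), HasDerivWithinAt (fun s => φ s x) (f (φ t x)) (Ici 0) t) (x) :
    ContinuousOn (fun s => φ s x) (Ici 0) := fun t ht => (hφ x t ht).continuousWithinAt

lemma flow_dist (hf : LipschitzWith K f) (hφ0 : ∀ x, φ 0 x = x)
    (hφ : ∀ x, ∀ t ∈ Ici (0:ℝ), HasDerivWithinAt (fun s => φ s x) (f (φ t x)) (Ici 0) t)
    (x y) (t : ℝ) (ht : 0 ≤ t) : dist (φ t x) (φ t y) ≤ dist x y * Real.exp (K * t) := by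
  have := dist_le_of_trajectories_ODE (v := fun _ => f) (K := K) (f := fun s => φ s x)
    (g := fun s => φ s y) (a := 0) (b := t) (δ := dist x y) (fun _ => hf)
    ((flow_cont hφ x).mono Icc_subset_Ici_self)
    (fun s hs => (hφ x s hs.1).mono (Ici_subset_Ici.2 hs.1))
    ((flow_cont hφ y).mono Icc_subset_Ici_self)
    (fun s hs => (hφ y s hs.1).mono (Ici_subset_Ici.2 hs.1)) (by simp [hφ0]) t ⟨ht, le_rfl⟩
  simpa using this

lemma flow_add (hf : LipschitzWith K f) (hφ0 : ∀ x, φ 0 x = x)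
    (hφ : ∀ x, ∀ t ∈ Ici (0:ℝ), HasDerivWithinAt (fun s => φ s x) (f (φ t x)) (Ici 0) t)
    (x) (t r : ℝ) (ht : 0 ≤ t) (hr : 0 ≤ r) : φ t (φ r x) = φ (t + r) x := by
  have hd : ∀ s ∈ Ici (0:ℝ), HasDerivWithinAt (fun s => φ (s + r) x) (f (φ (s + r) x)) (Ici 0) s := by
    intro s hs
    have h1 := hφ x (s + r) (add_nonneg hs hr)
    have h2 : HasDerivWithinAt (fun s : ℝ => s + r) 1 (Ici 0) s :=
      ((hasDerivAt_id s).add_const r).hasDerivWithinAt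
    have := h1.scomp s h2 (fun u hu => add_nonneg hu hr)
    rw [one_smul] at this
    exact this
  have := ODE_solution_unique (v := fun _ => f) (K := K) (f := fun s => φ s (φ r x))
    (g := fun s => φ (s + r) x) (a := 0) (b := t) (fun _ => hf)
    ((flow_cont hφ _).mono Icc_subset_Ici_self)
    (fun s hs => (hφ _ s hs.1).mono (Ici_subset_Ici.2 hs.1))
    (fun s hs => ((hd s hs.1).mono Icc_subset_Ici_self).continuousWithinAt)
    (fun s hs => (hd s hs.1).mono (Ici_subset_Ici.2 hs.1)) (by simp [hφ0])
  exact this ⟨ht, le_rfl⟩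

/-- Uniform first-order expansion near `x` for a Lipschitz function differentiable along the flow. -/
lemma local_expansion (hf : LipschitzWith K f) (hφ0 : ∀ x, φ 0 x = x)
    (hφ : ∀ x, ∀ t ∈ Ici (0:ℝ), HasDerivWithinAt (fun s => φ s x) (f (φ t x)) (Ici 0) t)
    {v D : (Fin n → ℝ) → ℝ} {L : NNReal} (hv : LipschitzWith L v) (hD : Continuous D)
    (hvD : ∀ z, ∀ r ∈ Ici (0:ℝ), HasDerivWithinAt (fun s => v (φ s z)) (D (φ r z)) (Ici 0) r)
    (x : Fin n → ℝ) (η : ℝ) (hη : 0 < η) :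
    ∃ ε > 0, ∃ δ > 0, ∀ z ∈ Metric.ball x ε, ∀ s ∈ Icc 0 δ,
      |(v (z + s • f x) - v z) - s * D x| ≤ s * η := by
  set η' := η / (L + 1) with hη'
  have hL : (0:ℝ) < L + 1 := by positivity
  have hη'0 : 0 < η' := by positivity
  obtain ⟨ρ₁, hρ₁, h1⟩ := Metric.continuousAt_iff.1 (hf.continuous.continuousAt (x := x)) η' hη'0
  obtain ⟨ρ₂, hρ₂, h2⟩ := Metric.continuousAt_iff.1 (hD.continuousAt (x := x)) η' hη'0
  set ρ := min ρ₁ ρ₂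
  have hρ : 0 < ρ := lt_min hρ₁ hρ₂
  have c1 : ∀ᶠ s in 𝓝[≥] (0:ℝ), dist (φ s x) x < ρ / 2 := by
    have := (flow_cont hφ x) 0 self_mem_Ici
    have := Metric.tendsto_nhds.1 this (ρ / 2) (by positivity)
    simpa [hφ0] using this
  have c2 : ∀ᶠ s in 𝓝[≥] (0:ℝ), Real.exp (K * s) < 2 := by
    have : ContinuousAt (fun s : ℝ => Real.exp (K * s)) 0 := by fun_prop
    have : ∀ᶠ s in 𝓝 (0:ℝ), Real.exp (K * s) < 2 := this.eventually_lt_const (by norm_num)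
    exact this.filter_mono nhdsWithin_le_nhds
  obtain ⟨δ, hδ, hδs⟩ := (mem_nhdsGE_iff_exists_Icc_subset).1 (c1.and c2)
  refine ⟨ρ / 4, by positivity, δ, hδ, ?_⟩
  intro z hz s hs
  have near : ∀ r ∈ Ico 0 s, dist (φ r z) x < ρ := by
    intro r hr
    have hr' := hδs (show r ∈ Icc 0 δ from ⟨hr.1, hr.2.le.trans hs.2⟩)
    have := flow_dist hf hφ0 hφ z x r hr.1
    have hz' : dist z x < ρ / 4 := hz
    calc dist (φ r z) x ≤ dist (φ r z) (φ r x) + dist (φ r x) x := dist_triangle _ _ _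
      _ < ρ / 4 * 2 + ρ / 2 := by
        have := mul_le_mul hz'.le hr'.2.le (Real.exp_nonneg _) (by positivity)
        linarith [hr'.1]
      _ = ρ := by ring
  have e1 : ‖(φ s z - s • f x) - (φ 0 z - (0:ℝ) • f x)‖ ≤ η' * (s - 0) := by
    refine norm_image_sub_le_of_norm_deriv_right_le_segment (f := fun s => φ s z - s • f x)
      (f' := fun r => f (φ r z) - f x) (C := η') (a := 0) (b := s) ?_ ?_ ?_ s ⟨hs.1, le_rfl⟩
    · exact ((flow_cont hφ z).mono Icc_subset_Ici_self).sub (by fun_prop)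
    · intro r hr
      have := ((hasDerivAt_id r).smul_const (f x)).hasDerivWithinAt (s := Ici r)
      simp only [one_smul] at this
      exact ((hφ z r hr.1).mono (Ici_subset_Ici.2 hr.1)).sub this
    · intro r hr
      rw [← dist_eq_norm]
      exact (h1 ((near r hr).trans_le (min_le_left _ _))).le
  have e2 : ‖(v (φ s z) - s * D x) - (v (φ 0 z) - 0 * D x)‖ ≤ η' * (s - 0) := by
    refine norm_image_sub_le_of_norm_deriv_right_le_segment (f := fun s => v (φ s z) - s * D x)
      (f' := fun r => D (φ r z) - D x) (C := η') (a := 0) (b := s) ?_ ?_ ?_ s ⟨hs.1, le_rfl⟩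
    · exact (hv.continuous.comp_continuousOn
        ((flow_cont hφ z).mono Icc_subset_Ici_self)).sub (by fun_prop)
    · intro r hr
      have := ((hasDerivAt_id r).mul_const (D x)).hasDerivWithinAt (s := Ici r)
      simp only [one_mul] at this
      exact ((hvD z r hr.1).mono (Ici_subset_Ici.2 hr.1)).sub this
    · intro r hr
      rw [← dist_eq_norm]
      exact (h2 ((near r hr).trans_le (min_le_right _ _))).le
  simp only [hφ0, zero_smul, sub_zero, zero_mul] at e1 e2
  have e3 : |v (z + s • f x) - v (φ s z)| ≤ L * (η' * s) := by
    rw [← Real.dist_eq]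
    refine (hv.dist_le_mul _ _).trans ?_
    gcongr
    rw [dist_comm, dist_eq_norm]
    rw [show φ s z - (z + s • f x) = φ s z - s • f x - z by abel]
    exact e1
  have e4 : η' * (L + 1) = η := by rw [hη']; field_simp
  rw [Real.norm_eq_abs] at e2
  calc _ = |(v (z + s • f x) - v (φ s z)) + (v (φ s z) - s * D x - v z)| := by congr 1; ring
    _ ≤ L * (η' * s) + η' * s := (abs_add_le _ _).trans (add_le_add e3 e2)
    _ = s * η := by rw [← e4]; ring

/-- The Liouville identity extends to bounded Lipschitz functions differentiable along the flow. -/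
lemma liouville_extend (hf : LipschitzWith K f) (hφ0 : ∀ x, φ 0 x = x)
    (hφ : ∀ x, ∀ t ∈ Ici (0:ℝ), HasDerivWithinAt (fun s => φ s x) (f (φ t x)) (Ici 0) t)
    {β : ℝ} {μ : Measure (Fin n → ℝ)} [IsFiniteMeasure μ]
    (hμc : ∃ K' : Set (Fin n → ℝ), IsCompact K' ∧ μ K'ᶜ = 0)
    {a : ℝ} {x₀ xT : Fin n → ℝ}
    (hLiouville : ∀ v : (Fin n → ℝ) → ℝ, ContDiff ℝ 1 v →
      a * v xT = v x₀ + ∫ x, (fderiv ℝ v x (f x) - β * v x) ∂μ)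
    {v D : (Fin n → ℝ) → ℝ} {L : NNReal} (hv : LipschitzWith L v) (hD : Continuous D)
    {M : ℝ} (hM : ∀ x, |v x| ≤ M)
    (hvD : ∀ z, ∀ r ∈ Ici (0:ℝ), HasDerivWithinAt (fun s => v (φ s z)) (D (φ r z)) (Ici 0) r) :
    a * v xT = v x₀ + ∫ x, (D x - β * v x) ∂μ := by
  have hM0 : 0 ≤ M := (abs_nonneg _).trans (hM 0)
  have hvc := hv.continuous
  choose A hA1 hA2 hA3 using fun k : ℕ => exists_moll n (1 / ((k:ℝ) + 1)) (by positivity)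
  have hsmall : ∀ ε > 0, ∀ᶠ k : ℕ in atTop, 1 / ((k:ℝ) + 1) < ε := fun ε hε =>
    (tendsto_one_div_add_atTop_nhds_zero_nat (𝕜 := ℝ)).eventually_lt_const hε
  have lim1 : ∀ x, Tendsto (fun k => A k v x) atTop (𝓝 (v x)) := by
    intro x
    rw [Metric.tendsto_nhds]
    intro η hη
    obtain ⟨ρ, hρ, h1⟩ := Metric.continuousAt_iff.1 (hvc.continuousAt (x := x)) (η/2) (by positivity)
    filter_upwards [hsmall ρ hρ] with k hk
    rw [Real.dist_eq]
    refine (hA3 k v hvc x (v x) (η/2) (by positivity) fun z hz => ?_).trans_lt (by linarith)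
    exact (h1 ((Metric.mem_ball.1 hz).trans hk)).le
  have hlip : ∀ k, LipschitzWith L (A k v) := by
    intro k
    refine LipschitzWith.of_dist_le_mul fun y x => ?_
    have e := hA2 k v hvc x (y - x)
    rw [add_sub_cancel] at e
    rw [Real.dist_eq, e]
    have := hA3 k (fun z => v (z + (y - x)) - v z) (by fun_prop) x 0 (L * dist y x) (by positivity)
      (fun z _ => by
        rw [sub_zero, ← Real.dist_eq]
        refine (hv.dist_le_mul _ _).trans (le_of_eq ?_)
        rw [dist_eq_norm, dist_eq_norm, add_sub_cancel_left])
    simpa using this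
  have lim2 : ∀ x, Tendsto (fun k => fderiv ℝ (A k v) x (f x)) atTop (𝓝 (D x)) := by
    intro x
    rw [Metric.tendsto_nhds]
    intro η hη
    obtain ⟨ε, hε, δ, hδ, H⟩ := local_expansion hf hφ0 hφ hv hD hvD x (η/2) (by positivity)
    filter_upwards [hsmall ε hε] with k hk
    have hd : HasDerivAt (fun s : ℝ => A k v (x + s • f x)) (fderiv ℝ (A k v) x (f x)) 0 := by
      have h1 : HasFDerivAt (A k v) (fderiv ℝ (A k v) x) (x + (0:ℝ) • f x) := by
        simpa using (((hA1 k v hvc).differentiable one_ne_zero) x).hasFDerivAt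
      have h2 : HasDerivAt (fun s : ℝ => x + s • f x) (f x) 0 := by
        simpa using ((hasDerivAt_id (0:ℝ)).smul_const (f x)).const_add x
      exact h1.comp_hasDerivAt _ h2
    have ht := hd.tendsto_slope_zero_right
    have hle : |fderiv ℝ (A k v) x (f x) - D x| ≤ η / 2 := by
      refine le_of_tendsto ((ht.sub_const (D x)).abs) ?_
      filter_upwards [Ioc_mem_nhdsGT hδ] with s hs
      have := hA3 k (fun z => v (z + s • f x) - v z) (by fun_prop) x (s * D x) (s * (η/2))
        (by have := hs.1; positivity)
        (fun z hz => H z ((Metric.mem_ball.1 hz).trans hk) s ⟨hs.1.le, hs.2⟩)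
      rw [← hA2 k v hvc] at this
      simp only [zero_add, zero_smul, add_zero, smul_eq_mul]
      have hs0 := hs.1
      have e : s⁻¹ * (A k v (x + s • f x) - A k v x) - D x
        = s⁻¹ * (A k v (x + s • f x) - A k v x - s * D x) := by field_simp
      rw [e, abs_mul, abs_of_pos (inv_pos.2 hs0)]
      calc _ ≤ s⁻¹ * (s * (η/2)) := by gcongr
        _ = η / 2 := by field_simp
    rw [Real.dist_eq]
    linarith
  have hint : Tendsto (fun k => ∫ x, (fderiv ℝ (A k v) x (f x) - β * A k v x) ∂μ) atTop
      (𝓝 (∫ x, (D x - β * v x) ∂μ)) := by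
    have hfi : Integrable (fun x => L * ‖f x‖ + |β| * M) μ := by
      refine Integrable.add (Integrable.const_mul ?_ _) (integrable_const _)
      obtain ⟨K', hK', h0⟩ := hμc
      have h1 : IntegrableOn (fun x => ‖f x‖) K' μ :=
        hf.continuous.norm.continuousOn.integrableOn_compact hK'
      have h2 : μ.restrict K' = μ := Measure.restrict_eq_self_of_ae_mem (by
        rw [ae_iff]; exact h0)
      rwa [IntegrableOn, h2] at h1
    refine tendsto_integral_of_dominated_convergence _ ?_ hfi ?_ ?_
    · intro k
      have c1 : Continuous (fderiv ℝ (A k v)) := (hA1 k v hvc).continuous_fderiv one_ne_zero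
      have c2 := (hA1 k v hvc).continuous
      exact ((c1.clm_apply hf.continuous).sub (c2.const_mul β)).aestronglyMeasurable
    · intro k
      refine Eventually.of_forall fun x => ?_
      refine (norm_sub_le _ _).trans (add_le_add ?_ ?_)
      · refine (ContinuousLinearMap.le_opNorm _ _).trans ?_
        gcongr
        exact norm_fderiv_le_of_lipschitz ℝ (hlip k)
      · rw [norm_mul, Real.norm_eq_abs, Real.norm_eq_abs]
        gcongr
        simpa using hA3 k v hvc x 0 M hM0 (fun z _ => by simpa using hM z)
    · exact Eventually.of_forall fun x => (lim2 x).sub ((lim1 x).const_mul β)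
  refine tendsto_nhds_unique ((lim1 xT).const_mul a) ?_
  refine ((lim1 x₀).add hint).congr fun k => ?_
  exact (hLiouville _ (hA1 k v hvc)).symm

end flow

/-- Two-Diracs case of the superposition theorem, representation of the occupation
measure: `μ` is the superposition of the discounted occupation measures of two
trajectories starting at `x₀`, one stopped at time `τ` and one running forever, with
weights `a e^{βτ}` and `1 − a e^{βτ}`. -/
theorem liouville_two_diracs_occupation {n : ℕ}
    (f : (Fin n → ℝ) → (Fin n → ℝ)) (K : NNReal) (hf : LipschitzWith K f)
    (φ : ℝ → (Fin n → ℝ) → (Fin n → ℝ))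
    (hφ0 : ∀ x, φ 0 x = x)
    (hφ : ∀ x, ∀ t ∈ Ici (0:ℝ), HasDerivWithinAt (fun s => φ s x) (f (φ t x)) (Ici 0) t)
    (β : ℝ) (hβ : 0 < β)
    (μ : Measure (Fin n → ℝ)) [IsFiniteMeasure μ]
    (hμc : ∃ K' : Set (Fin n → ℝ), IsCompact K' ∧ μ K'ᶜ = 0)
    (a : ℝ) (ha : 0 < a) (x₀ xT : Fin n → ℝ) (τ : ℝ) (hτ : 0 ≤ τ)
    (hreach : φ τ x₀ = xT) (haτ : a * Real.exp (β * τ) ≤ 1)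
    (hLiouville : ∀ v : (Fin n → ℝ) → ℝ, ContDiff ℝ 1 v →
      a * v xT = v x₀ + ∫ x, (fderiv ℝ v x (f x) - β * v x) ∂μ) :
    ∀ w : (Fin n → ℝ) → ℝ, ContDiff ℝ 1 w → HasCompactSupport w →
      ∫ x, w x ∂μ =
        a * Real.exp (β * τ) * (∫ t in (0:ℝ)..τ, Real.exp (-β * t) * w (φ t x₀)) +
        (1 - a * Real.exp (β * τ)) * ∫ t in Ici (0:ℝ), Real.exp (-β * t) * w (φ t x₀) := by
  intro w hw hwc
  obtain ⟨Lw, hLw⟩ := hw.lipschitzWith_of_hasCompactSupport hwc one_ne_zero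
  obtain ⟨M, hM⟩ := hwc.exists_bound_of_continuous hw.continuous
  have hM0 : 0 ≤ M := (norm_nonneg _).trans (hM 0)
  have hwcont := hw.continuous
  set g : (Fin n → ℝ) → ℝ → ℝ := fun z t => Real.exp (-β * t) * w (φ (max t 0) z) with hg
  have hgc : ∀ z, Continuous (g z) := by
    intro z
    have : Continuous fun t : ℝ => φ (max t 0) z :=
      (flow_cont hφ z).comp_continuous (by fun_prop) (fun t => mem_Ici.2 (le_max_right _ _))
    exact (by fun_prop : Continuous fun t : ℝ => Real.exp (-β * t)).mul (hwcont.comp this)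
  have hgi : ∀ z b c, IntervalIntegrable (g z) volume b c := fun z b c =>
    (hgc z).intervalIntegrable b c
  have hgM : ∀ z t, ‖g z t‖ ≤ Real.exp (-β * t) * M := by
    intro z t
    rw [hg, norm_mul, Real.norm_eq_abs, abs_of_pos (Real.exp_pos _)]
    gcongr
    exact hM _
  set G : (Fin n → ℝ) → ℝ → ℝ := fun z u => ∫ t in (0:ℝ)..u, g z t with hG
  have hGd : ∀ z u, HasDerivAt (G z) (g z u) u := fun z u =>
    intervalIntegral.integral_hasDerivAt_right (hgi z _ _)
      ((hgc z).stronglyMeasurableAtFilter _ _) (hgc z).continuousAt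
  have shift : ∀ z r S, 0 ≤ r → 0 ≤ S →
      G (φ r z) S = Real.exp (β * r) * (G z (S + r) - G z r) := by
    intro z r S hr hS
    have e1 : G z (S + r) - G z r = ∫ t in r..(S + r), g z t :=
      intervalIntegral.integral_interval_sub_left (hgi z _ _) (hgi z _ _)
    have e2 : (∫ t in r..(S + r), g z t) = ∫ t in (0:ℝ)..S, g z (t + r) := by
      rw [intervalIntegral.integral_comp_add_right (fun t => g z t)]; simp
    rw [e1, e2, ← intervalIntegral.integral_const_mul]
    apply intervalIntegral.integral_congr
    intro t ht
    rw [uIcc_of_le hS] at ht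
    simp only [hg]
    rw [max_eq_left ht.1, max_eq_left (add_nonneg ht.1 hr), flow_add hf hφ0 hφ z t r ht.1 hr,
      ← mul_assoc, ← Real.exp_add]
    congr 2
    ring
  have hφS : ∀ S, 0 ≤ S → Continuous (φ S) := by
    intro S hS
    refine (LipschitzWith.of_dist_le_mul (K := ⟨Real.exp (K * S), (Real.exp_pos _).le⟩)
      fun x y => ?_).continuous
    rw [mul_comm]
    exact flow_dist hf hφ0 hφ x y S hS
  have key : ∀ S, 0 ≤ S → ∫ x, w x ∂μ =
      G x₀ S - a * (Real.exp (β * τ) * (G x₀ (S + τ) - G x₀ τ))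
        + Real.exp (-β * S) * ∫ x, w (φ S x) ∂μ := by
    intro S hS
    have hVlip : LipschitzWith ⟨Lw * Real.exp (K * S) * S, by positivity⟩ (fun z => G z S) := by
      refine LipschitzWith.of_dist_le_mul fun x y => ?_
      rw [dist_eq_norm]
      simp only [hG]
      rw [← intervalIntegral.integral_sub (hgi x _ _) (hgi y _ _)]
      refine (intervalIntegral.norm_integral_le_of_norm_le_const
        (C := Lw * (dist x y * Real.exp (K * S))) ?_).trans (le_of_eq ?_)
      · intro t ht
        rw [uIoc_of_le hS] at ht
        simp only [hg]
        rw [max_eq_left ht.1.le, ← mul_sub, norm_mul, Real.norm_eq_abs,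
          abs_of_pos (Real.exp_pos _), ← dist_eq_norm]
        have b1 : Real.exp (-β * t) ≤ 1 := Real.exp_le_one_iff.2 (by nlinarith [ht.1])
        have b2 : dist (w (φ t x)) (w (φ t y)) ≤ Lw * (dist x y * Real.exp (K * S)) := by
          refine (hLw.dist_le_mul _ _).trans ?_
          gcongr
          refine (flow_dist hf hφ0 hφ x y t ht.1.le).trans ?_
          gcongr
          exact ht.2
        calc _ ≤ 1 * dist (w (φ t x)) (w (φ t y)) := by gcongr
          _ ≤ _ := by rw [one_mul]; exact b2
      · rw [sub_zero, abs_of_nonneg hS]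
        change _ = Lw * Real.exp (K * S) * S * dist x y
        ring
    have hVM : ∀ z, |G z S| ≤ M * |S - 0| := by
      intro z
      rw [← Real.norm_eq_abs (G z S)]
      refine intervalIntegral.norm_integral_le_of_norm_le_const (f := g z) fun t ht => ?_
      rw [uIoc_of_le hS] at ht
      refine (hgM z t).trans ?_
      have b1 : Real.exp (-β * t) ≤ 1 := Real.exp_le_one_iff.2 (by nlinarith [ht.1])
      nlinarith
    have hDc : Continuous fun z => β * G z S + (Real.exp (-β * S) * w (φ S z) - w z) := by
      have := hVlip.continuous
      have := hwcont.comp (hφS S hS)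
      fun_prop
    have hvD : ∀ z, ∀ r ∈ Ici (0:ℝ), HasDerivWithinAt (fun s => G (φ s z) S)
        ((fun z => β * G z S + (Real.exp (-β * S) * w (φ S z) - w z)) (φ r z)) (Ici 0) r := by
      intro z r hr
      have d1 : HasDerivAt (fun s : ℝ => Real.exp (β * s)) (Real.exp (β * r) * β) r := by
        simpa using ((hasDerivAt_id r).const_mul β).exp
      have d2 : HasDerivAt (fun s : ℝ => G z (S + s)) (g z (S + r)) r := by
        simpa using (hGd z (S + r)).comp_const_add S r
      have d3 := (d1.mul (d2.sub (hGd z r))).hasDerivWithinAt (s := Ici 0)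
      refine (d3.congr_deriv ?_).congr (fun s hs => shift z s S hs hS) (shift z r S hr hS)
      have hr' : (0:ℝ) ≤ r := hr
      simp only [shift z r S hr hS, hg, Pi.sub_apply]
      rw [max_eq_left hr', max_eq_left (add_nonneg hS hr'), flow_add hf hφ0 hφ z S r hS hr]
      have x1 : Real.exp (-β * (S + r)) = Real.exp (-β * S) * Real.exp (-β * r) := by
        rw [← Real.exp_add]; congr 1; ring
      have x2 : Real.exp (β * r) * Real.exp (-β * r) = 1 := by
        rw [← Real.exp_add]; simp
      rw [x1]
      linear_combination (Real.exp (-β * S) * w (φ (S + r) z) - w (φ r z)) * x2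
    have := liouville_extend hf hφ0 hφ hμc hLiouville hVlip hDc hVM hvD
    simp only [add_sub_cancel_left] at this
    have i1 : Integrable (fun x => w (φ S x)) μ :=
      Integrable.of_bound (hwcont.comp (hφS S hS)).aestronglyMeasurable M
        (Eventually.of_forall fun x => hM _)
    have i2 : Integrable w μ :=
      Integrable.of_bound hwcont.aestronglyMeasurable M (Eventually.of_forall fun x => hM _)
    rw [integral_sub (i1.const_mul _) i2, integral_const_mul, ← hreach,
      shift x₀ τ S hτ hS] at this
    linarith
  have hexp : IntegrableOn (fun t => Real.exp (-β * t)) (Ioi 0) := by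
    exact integrableOn_exp_mul_Ioi (by linarith) 0
  have hgint : IntegrableOn (g x₀) (Ioi 0) :=
    Integrable.mono' (hexp.mul_const M) (hgc x₀).aestronglyMeasurable
      (Eventually.of_forall fun t => hgM x₀ t)
  have T1 : Tendsto (fun S : ℝ => G x₀ S) atTop (𝓝 (∫ t in Ioi (0:ℝ), g x₀ t)) :=
    intervalIntegral_tendsto_integral_Ioi 0 hgint tendsto_id
  have T2 : Tendsto (fun S : ℝ => G x₀ (S + τ)) atTop (𝓝 (∫ t in Ioi (0:ℝ), g x₀ t)) :=
    T1.comp (tendsto_atTop_add_const_right _ _ tendsto_id)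
  have T3 : Tendsto (fun S : ℝ => Real.exp (-β * S) * ∫ x, w (φ S x) ∂μ) atTop (𝓝 0) := by
    have t : Tendsto (fun S : ℝ => Real.exp (-β * S)) atTop (𝓝 0) :=
      Real.tendsto_exp_atBot.comp (tendsto_id.const_mul_atTop_of_neg (by linarith))
    have t' := t.mul_const (M * μ.real univ)
    rw [zero_mul] at t'
    refine squeeze_zero_norm (fun S => ?_) t'
    rw [norm_mul, Real.norm_eq_abs, abs_of_pos (Real.exp_pos _)]
    gcongr
    exact norm_integral_le_of_norm_le_const (Eventually.of_forall fun x => hM _)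
  have T := (T1.sub (((T2.sub_const (G x₀ τ)).const_mul (Real.exp (β * τ))).const_mul a)).add T3
  have hfin : ∫ x, w x ∂μ = _ := tendsto_nhds_unique
    (tendsto_const_nhds.congr' ((eventually_ge_atTop (0:ℝ)).mono key)) T
  have I1 : (∫ t in (0:ℝ)..τ, Real.exp (-β * t) * w (φ t x₀)) = G x₀ τ := by
    apply intervalIntegral.integral_congr
    intro t ht
    rw [uIcc_of_le hτ] at ht
    simp only [hg, max_eq_left ht.1]
  have I2 : (∫ t in Ici (0:ℝ), Real.exp (-β * t) * w (φ t x₀)) = ∫ t in Ioi (0:ℝ), g x₀ t := by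
    rw [integral_Ici_eq_integral_Ioi]
    refine setIntegral_congr_fun measurableSet_Ioi fun t ht => ?_
    simp only [hg, max_eq_left (le_of_lt (mem_Ioi.1 ht))]
  rw [I1, I2, hfin]
  ring
end

section
/- Let f̄ : ℝⁿ → ℝⁿ be globally Lipschitz with flow φ, let β > 0, let μ be a finite compactly supported nonnegative Borel measure on ℝⁿ, let x_0 ∈ ℝⁿ, let (x_i)_{i∈ℕ} be points of ℝⁿ contained in a compact set and (a_i)_{i∈ℕ} positive reals with Σ_i a_i < ∞, and suppose that for every continuously differentiable v : ℝⁿ → ℝ one has Σ_{i=1}^∞ a_i v(x_i) = v(x_0) + ∫_{ℝⁿ} ( ∇v(x)·f̄(x) − β v(x) ) dμ(x). Then there exist times τ_i ≥ 0 such that φ(τ_i, x_0) = x_i for every i and Σ_{i=1}^∞ a_i e^{β τ_i} ≤ 1. -/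
open MeasureTheory Set Filter Topology

/-- Comparison of the flow with the straight line in direction `w`. -/
lemma aux_line {n : ℕ}
    (f : (Fin n → ℝ) → (Fin n → ℝ)) (K : NNReal) (hK : 0 < K) (hf : LipschitzWith K f)
    (φ : ℝ → (Fin n → ℝ) → (Fin n → ℝ))
    (hφ0 : ∀ x, φ 0 x = x)
    (hφ : ∀ x, ∀ t ∈ Ici (0:ℝ), HasDerivWithinAt (fun s => φ s x) (f (φ t x)) (Ici 0) t)
    (z w : Fin n → ℝ) (ε : ℝ) (hw : dist w (f z) ≤ K * ε) (t : ℝ) (ht : 0 ≤ t) :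
    dist (z + t • w) (φ t z) ≤ (ε + t * ‖w‖) * (Real.exp (K * t) - 1) := by
  have hK' : (0:ℝ) < K := by exact_mod_cast hK
  have h := dist_le_of_approx_trajectories_ODE (v := fun _ => f) (K := K)
    (f := fun s => z + s • w) (f' := fun _ => w) (g := fun s => φ s z)
    (g' := fun s => f (φ s z)) (a := 0) (b := t) (εf := K * ε + K * (t * ‖w‖)) (εg := 0) (δ := 0)
    (fun _ => hf) (by fun_prop)
    (fun s _ => by
      have : HasDerivAt (fun s : ℝ => z + s • w) ((1:ℝ) • w) s :=
        ((hasDerivAt_id s).smul_const w).const_add z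
      simpa using this.hasDerivWithinAt)
    (fun s hs => by
      refine (dist_triangle _ (f z) _).trans (add_le_add hw ?_)
      refine (hf.dist_le_mul _ _).trans ?_
      have : dist z (z + s • w) = s * ‖w‖ := by
        rw [dist_eq_norm]; simp [norm_smul, abs_of_nonneg hs.1]
      rw [this]
      have := hs.2.le
      gcongr)
    (fun s hs => ((hφ z s hs.1).continuousWithinAt.mono Icc_subset_Ici_self))
    (fun s hs => (hφ z s hs.1).mono (Ici_subset_Ici.2 hs.1))
    (fun s _ => by simp) (by simp [hφ0]) t ⟨ht, le_rfl⟩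
  refine h.trans (le_of_eq ?_)
  rw [gronwallBound_of_K_ne_0 hK'.ne']
  simp only [sub_zero, add_zero]
  field_simp
  ring

/-- Lipschitz functions growing at most like `e^{βt}` along the flow are admissible. -/
lemma aux_moll {n : ℕ}
    (f : (Fin n → ℝ) → (Fin n → ℝ)) (K : NNReal) (hK : 0 < K) (hf : LipschitzWith K f)
    (φ : ℝ → (Fin n → ℝ) → (Fin n → ℝ))
    (hφ0 : ∀ x, φ 0 x = x)
    (hφ : ∀ x, ∀ t ∈ Ici (0:ℝ), HasDerivWithinAt (fun s => φ s x) (f (φ t x)) (Ici 0) t)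
    (β : ℝ) (v : (Fin n → ℝ) → ℝ) (k : NNReal) (hv : LipschitzWith k v)
    (hvφ : ∀ x, ∀ t, 0 ≤ t → v (φ t x) ≤ Real.exp (β * t) * v x) (ε : ℝ) (hε : 0 < ε) :
    ∃ u : (Fin n → ℝ) → ℝ, ContDiff ℝ 1 u ∧ (∀ x, dist (u x) (v x) ≤ k * ε) ∧
      ∀ x, fderiv ℝ u x (f x) - β * u x ≤ k * (ε * K) := by
  let ρ : ContDiffBump (0 : Fin n → ℝ) := ⟨ε / 2, ε, by positivity, by linarith⟩
  let r := ρ.normed volume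
  let u : (Fin n → ℝ) → ℝ := convolution r v (ContinuousLinearMap.lsmul ℝ ℝ) volume
  have hu : ∀ x, u x = ∫ y, r y * v (x - y) := fun x => rfl
  have hrc : Continuous r := ρ.continuous_normed
  have hrs : HasCompactSupport r := ρ.hasCompactSupport_normed
  have hint : ∀ x, Integrable (fun y => r y * v (x - y)) := fun x => by
    refine Continuous.integrable_of_hasCompactSupport ?_ hrs.mul_right
    have := hv.continuous
    fun_prop
  have hr1 : ∫ y, r y = 1 := ρ.integral_normed
  have hri : Integrable r := ρ.integrable_normed
  have hcd : ContDiff ℝ 1 u :=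
    hrs.contDiff_convolution_left (n := 1) _ ρ.contDiff_normed hv.continuous.locallyIntegrable
  refine ⟨u, hcd, fun x => ?_, fun x => ?_⟩
  · refine ρ.dist_normed_convolution_le hv.continuous.aestronglyMeasurable fun y hy => ?_
    refine (hv.dist_le_mul _ _).trans ?_
    have : dist y x ≤ ε := (Metric.mem_ball.1 hy).le
    gcongr
  · set w := f x with hw
    have key : ∀ t : ℝ, 0 ≤ t → u (x + t • w) ≤ Real.exp (β * t) * u x +
        k * ((ε + t * ‖w‖) * (Real.exp (K * t) - 1)) := by
      intro t ht
      set c := k * ((ε + t * ‖w‖) * (Real.exp (K * t) - 1)) with hc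
      have e : Real.exp (β * t) * u x + c
          = ∫ y, (Real.exp (β * t) * (r y * v (x - y)) + r y * c) := by
        rw [integral_add ((hint x).const_mul _) (hri.mul_const _), integral_const_mul,
          integral_mul_const, hr1, one_mul, hu]
      rw [e, hu]
      refine integral_mono (hint _) (((hint x).const_mul _).add (hri.mul_const _)) fun y => ?_
      by_cases hy : r y = 0
      · simp [hy]
      have hy' : y ∈ Metric.ball (0 : Fin n → ℝ) ε := by
        have : y ∈ Function.support r := hy
        rwa [show Function.support r = _ from ρ.support_normed_eq] at this
      have hd : dist w (f (x - y)) ≤ K * ε := by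
        refine (hf.dist_le_mul _ _).trans ?_
        have : dist x (x - y) ≤ ε := by
          rw [dist_eq_norm]; simpa using (mem_ball_zero_iff.1 hy').le
        gcongr
      have h1 := aux_line f K hK hf φ hφ0 hφ (x - y) w ε hd t ht
      have h2 := hv.dist_le_mul (x - y + t • w) (φ t (x - y))
      have h3 := (le_abs_self _).trans h2
      have h4 : (k:ℝ) * dist (x - y + t • w) (φ t (x - y)) ≤ c := by
        rw [hc]; gcongr
      have h5 := hvφ (x - y) t ht
      have h6 : v (x + t • w - y) ≤ Real.exp (β * t) * v (x - y) + c := by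
        rw [show x + t • w - y = x - y + t • w by abel]; linarith
      have h7 := mul_le_mul_of_nonneg_left h6 (ρ.nonneg_normed (μ := volume) y)
      change r y * _ ≤ r y * _ at h7
      change r y * v (x + t • w - y) ≤ Real.exp (β * t) * (r y * v (x - y)) + r y * c
      linarith
    have hd1 : HasDerivAt (fun t : ℝ => u (x + t • w)) (fderiv ℝ u x w) 0 := by
      have h1 : HasDerivAt (fun s : ℝ => x + s • w) ((1:ℝ) • w) 0 :=
        ((hasDerivAt_id (0:ℝ)).smul_const w).const_add x
      have h2 : HasFDerivAt u (fderiv ℝ u x) (x + (0:ℝ) • w) := by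
        simpa using (hcd.differentiable (by norm_num) x).hasFDerivAt
      have h3 := h2.comp_hasDerivAt (0:ℝ) h1
      rw [one_smul] at h3
      exact h3
    have hd2 : HasDerivAt (fun t : ℝ => Real.exp (β * t) * u x +
        k * ((ε + t * ‖w‖) * (Real.exp (K * t) - 1))) (β * u x + k * (ε * K)) 0 := by
      have e1 : ∀ b : ℝ, HasDerivAt (fun t : ℝ => Real.exp (b * t)) b 0 := fun b => by
        have := ((hasDerivAt_id (0:ℝ)).const_mul b).exp
        simpa using this
      have e2 : HasDerivAt (fun t : ℝ => ε + t * ‖w‖) (‖w‖) 0 := by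
        simpa using ((hasDerivAt_id (0:ℝ)).mul_const ‖w‖).const_add ε
      have := ((e1 β).mul_const (u x)).add (((e2.mul ((e1 K).sub_const 1))).const_mul (k:ℝ))
      refine HasDerivAt.congr_deriv this ?_
      simp
    have := le_of_tendsto_of_tendsto hd1.tendsto_slope_zero_right hd2.tendsto_slope_zero_right (by
      filter_upwards [self_mem_nhdsWithin] with t ht
      have ht' : 0 < t := ht
      have := key t ht'.le
      simp only [smul_eq_mul, zero_add, mul_zero, zero_smul, add_zero, Real.exp_zero, sub_self,
        one_mul]
      gcongr)
    linarith

lemma aux_test {n : ℕ}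
    (f : (Fin n → ℝ) → (Fin n → ℝ)) (K : NNReal) (hK : 0 < K) (hf : LipschitzWith K f)
    (φ : ℝ → (Fin n → ℝ) → (Fin n → ℝ))
    (hφ0 : ∀ x, φ 0 x = x)
    (hφ : ∀ x, ∀ t ∈ Ici (0:ℝ), HasDerivWithinAt (fun s => φ s x) (f (φ t x)) (Ici 0) t)
    (β : ℝ)
    (μ : Measure (Fin n → ℝ)) [IsFiniteMeasure μ]
    (x₀ : Fin n → ℝ) (xs : ℕ → Fin n → ℝ)
    (hxs : ∃ C : Set (Fin n → ℝ), IsCompact C ∧ ∀ i, xs i ∈ C)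
    (a : ℕ → ℝ) (ha : ∀ i, 0 < a i) (hsum : Summable a)
    (hLiouville : ∀ v : (Fin n → ℝ) → ℝ, ContDiff ℝ 1 v →
      ∑' i, a i * v (xs i) = v x₀ + ∫ x, (fderiv ℝ v x (f x) - β * v x) ∂μ)
    (v : (Fin n → ℝ) → ℝ) (k : NNReal) (hv : LipschitzWith k v)
    (hvφ : ∀ x, ∀ t, 0 ≤ t → v (φ t x) ≤ Real.exp (β * t) * v x) :
    Summable (fun i => a i * v (xs i)) ∧ ∑' i, a i * v (xs i) ≤ v x₀ := by
  obtain ⟨C, hC, hxC⟩ := hxs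
  have hs : ∀ u : (Fin n → ℝ) → ℝ, Continuous u → Summable (fun i => a i * u (xs i)) := by
    intro u hu
    obtain ⟨B, hB⟩ := hC.exists_bound_of_continuousOn hu.continuousOn
    refine Summable.of_norm_bounded (hsum.mul_right B) fun i => ?_
    rw [norm_mul, Real.norm_of_nonneg (ha i).le]
    exact mul_le_mul_of_nonneg_left (hB _ (hxC i)) (ha i).le
  refine ⟨hs v hv.continuous, ?_⟩
  set A := ∑' i, a i with hA
  have main : ∀ ε : ℝ, 0 < ε → ∑' i, a i * v (xs i) ≤
      v x₀ + (k * A + k + μ.real univ * (k * K)) * ε := by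
    intro ε hε
    obtain ⟨u, hu, huv, hfu⟩ := aux_moll f K hK hf φ hφ0 hφ β v k hv hvφ ε hε
    have h1 := hLiouville u hu
    have h2 : ∫ x, (fderiv ℝ u x (f x) - β * u x) ∂μ ≤ μ.real univ * (k * (ε * K)) := by
      by_cases hi : Integrable (fun x => fderiv ℝ u x (f x) - β * u x) μ
      · have := integral_mono hi (integrable_const ((k:ℝ) * (ε * K))) hfu
        simpa using this
      · rw [integral_undef hi]; positivity
    have h3 : u x₀ ≤ v x₀ + k * ε := by
      have := (le_abs_self _).trans (huv x₀); linarith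
    have h4 : ∑' i, a i * v (xs i) ≤ ∑' i, (a i * u (xs i) + a i * (k * ε)) := by
      refine (hs v hv.continuous).tsum_le_tsum (fun i => ?_)
        ((hs u hu.continuous).add (hsum.mul_right _))
      have := (neg_le_abs _).trans (huv (xs i))
      rw [← mul_add]
      exact mul_le_mul_of_nonneg_left (by linarith) (ha i).le
    rw [(hs u hu.continuous).tsum_add (hsum.mul_right _), tsum_mul_right, ← hA] at h4
    linarith
  refine le_of_forall_pos_le_add fun δ hδ => ?_
  have hA0 : 0 ≤ A := tsum_nonneg fun i => (ha i).le
  set D := k * A + k + μ.real univ * (k * K) with hD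
  have hD0 : 0 ≤ D := by positivity
  refine (main (δ / (D + 1)) (by positivity)).trans ?_
  have : D * (δ / (D + 1)) ≤ δ := by
    rw [mul_div_assoc', div_le_iff₀ (by positivity)]; nlinarith
  linarith

/-- The regularised exponential hitting time. -/
noncomputable def auxV {n : ℕ} (φ : ℝ → (Fin n → ℝ) → (Fin n → ℝ)) (β L : ℝ)
    (x₀ : Fin n → ℝ) (k : ℕ) (x : Fin n → ℝ) : ℝ :=
  ⨅ s : NNReal, Real.exp (β * s) * (1 + k * (Real.exp (-(L * s)) * dist (φ s x₀) x))

section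
variable {n : ℕ} (φ : ℝ → (Fin n → ℝ) → (Fin n → ℝ)) (β L : ℝ) (hβ : 0 < β)
    (x₀ : Fin n → ℝ)

lemma auxV_one (hβ : 0 < β) (k : ℕ) (x : Fin n → ℝ) (s : NNReal) :
    1 ≤ Real.exp (β * s) * (1 + k * (Real.exp (-(L * s)) * dist (φ s x₀) x)) := by
  have h1 : 1 ≤ Real.exp (β * s) := Real.one_le_exp (by positivity)
  have h2 : 0 ≤ k * (Real.exp (-(L * s)) * dist (φ s x₀) x) := by positivity
  nlinarith

lemma auxV_bdd (hβ : 0 < β) (k : ℕ) (x : Fin n → ℝ) : BddBelow (range fun s : NNReal =>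
    Real.exp (β * s) * (1 + k * (Real.exp (-(L * s)) * dist (φ s x₀) x))) :=
  ⟨1, by rintro _ ⟨s, rfl⟩; exact auxV_one φ β L x₀ hβ k x s⟩

lemma auxV_ge (hβ : 0 < β) (k : ℕ) (x : Fin n → ℝ) : 1 ≤ auxV φ β L x₀ k x :=
  le_ciInf fun s => auxV_one φ β L x₀ hβ k x s

lemma auxV_x0 (hβ : 0 < β) (hφ0 : ∀ x, φ 0 x = x) (k : ℕ) : auxV φ β L x₀ k x₀ ≤ 1 :=
  ciInf_le_of_le (auxV_bdd φ β L x₀ hβ k x₀) 0 (by simp [hφ0])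

lemma auxV_mono (hβ : 0 < β) (x : Fin n → ℝ) : Monotone fun k => auxV φ β L x₀ k x := by
  intro k l hkl
  refine ciInf_mono (auxV_bdd φ β L x₀ hβ k x) fun s => ?_
  have : (k:ℝ) ≤ l := by exact_mod_cast hkl
  gcongr

lemma auxV_lip (hβ : 0 < β) (hL : β ≤ L) (k : ℕ) :
    LipschitzWith (k : NNReal) (auxV φ β L x₀ k) := by
  refine LipschitzWith.of_le_add_mul _ fun x y => ?_
  rw [← sub_le_iff_le_add]
  refine le_ciInf fun s => ?_
  rw [sub_le_iff_le_add]
  refine (ciInf_le (auxV_bdd φ β L x₀ hβ k x) s).trans ?_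
  have h1 : dist (φ s x₀) x ≤ dist (φ s x₀) y + dist x y := by
    rw [dist_comm x y]; exact dist_triangle _ _ _
  have h2 : Real.exp (β * s) * Real.exp (-(L * s)) ≤ 1 := by
    rw [← Real.exp_add, Real.exp_le_one_iff]
    have := mul_le_mul_of_nonneg_right hL s.2
    change β * (s:ℝ) ≤ L * s at this
    linarith
  set p := Real.exp (β * s) with hp
  set q := Real.exp (-(L * s)) with hq
  calc p * (1 + k * (q * dist (φ s x₀) x))
      ≤ p * (1 + k * (q * (dist (φ s x₀) y + dist x y))) := by gcongr
    _ = p * (1 + k * (q * dist (φ s x₀) y)) + (p * q) * (k * dist x y) := by ring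
    _ ≤ p * (1 + k * (q * dist (φ s x₀) y)) + 1 * (k * dist x y) := by gcongr
    _ = _ := by simp

lemma auxV_flow (hβ : 0 < β) (f : (Fin n → ℝ) → (Fin n → ℝ)) (K : NNReal)
    (hf : LipschitzWith K f) (hφ0 : ∀ x, φ 0 x = x)
    (hφ : ∀ x, ∀ t ∈ Ici (0:ℝ), HasDerivWithinAt (fun s => φ s x) (f (φ t x)) (Ici 0) t)
    (k : ℕ) (x : Fin n → ℝ) (t : ℝ) (ht : 0 ≤ t) :
    auxV φ β K x₀ k (φ t x) ≤ Real.exp (β * t) * auxV φ β K x₀ k x := by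
  rw [← div_le_iff₀' (Real.exp_pos _)]
  refine le_ciInf fun s => ?_
  rw [div_le_iff₀' (Real.exp_pos _)]
  refine (ciInf_le (auxV_bdd φ β K x₀ hβ k _) (s + ⟨t, ht⟩)).trans ?_
  have hs : (0:ℝ) ≤ s := s.2
  have hcoe : ((s + ⟨t, ht⟩ : NNReal) : ℝ) = s + t := rfl
  rw [hcoe]
  have hder : ∀ u ∈ Ici (0:ℝ), HasDerivWithinAt (fun u => φ (s + u) x₀)
      (f (φ (s + u) x₀)) (Ici 0) u := by
    intro u hu
    have h1 := hφ x₀ (s + u) (add_nonneg hs hu)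
    have h2 : HasDerivWithinAt (fun u : ℝ => (s:ℝ) + u) 1 (Ici 0) u :=
      ((hasDerivAt_id u).const_add (s:ℝ)).hasDerivWithinAt
    have := h1.scomp u h2 (fun y hy => add_nonneg hs hy)
    rw [one_smul] at this
    exact this
  have h := dist_le_of_trajectories_ODE (v := fun _ => f) (K := K)
    (f := fun u => φ (s + u) x₀) (g := fun u => φ u x) (a := 0) (b := t) (δ := dist (φ s x₀) x)
    (fun _ => hf)
    (fun u hu => ((hder u hu.1).continuousWithinAt.mono Icc_subset_Ici_self))
    (fun u hu => (hder u hu.1).mono (Ici_subset_Ici.2 hu.1))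
    (fun u hu => ((hφ x u hu.1).continuousWithinAt.mono Icc_subset_Ici_self))
    (fun u hu => (hφ x u hu.1).mono (Ici_subset_Ici.2 hu.1))
    (by simp [hφ0]) t ⟨ht, le_rfl⟩
  simp only [sub_zero] at h
  have e1 : Real.exp (β * (s + t)) = Real.exp (β * t) * Real.exp (β * s) := by
    rw [← Real.exp_add]; ring_nf
  have e2 : Real.exp (-(K * (s + t))) * (dist (φ s x₀) x * Real.exp (K * t))
      = Real.exp (-(K * s)) * dist (φ s x₀) x := by
    have : Real.exp (-((K:ℝ) * s)) = Real.exp (-(K * (s + t))) * Real.exp (K * t) := by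
      rw [← Real.exp_add]; ring_nf
    rw [this]; ring
  rw [e1, mul_assoc, ← e2]
  gcongr

lemma auxV_limit (hβ : 0 < β) (hL : 0 < L)
    (hφc : ContinuousOn (fun s => φ s x₀) (Ici 0)) (x : Fin n → ℝ) (M : ℝ)
    (hM : ∀ k, auxV φ β L x₀ k x ≤ M) :
    ∃ τ : ℝ, 0 ≤ τ ∧ φ τ x₀ = x ∧ Real.exp (β * τ) ≤ M := by
  have h : ∀ k : ℕ, ∃ s : NNReal, Real.exp (β * s) *
      (1 + k * (Real.exp (-(L * s)) * dist (φ s x₀) x)) < M + 1 / ((k:ℝ) + 1) := fun k =>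
    exists_lt_of_ciInf_lt ((hM k).trans_lt (by
      have : 0 < 1 / ((k:ℝ) + 1) := by positivity
      linarith))
  choose s hs using h
  have hM1 : 1 ≤ M := (auxV_ge φ β L x₀ hβ 0 x).trans (hM 0)
  have hexp : ∀ k, Real.exp (β * s k) ≤ M + 1 / ((k:ℝ) + 1) := fun k => by
    refine le_trans ?_ (hs k).le
    have : 0 ≤ k * (Real.exp (-(L * s k)) * dist (φ (s k) x₀) x) := by positivity
    nlinarith [Real.exp_pos (β * s k)]
  have hk1 : ∀ k : ℕ, 1 / ((k:ℝ) + 1) ≤ 1 := fun k => by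
    rw [div_le_one (by positivity)]; linarith [k.cast_nonneg (α := ℝ)]
  set T := Real.log (M + 1) / β with hT
  have hsT : ∀ k, (s k : ℝ) ∈ Icc 0 T := fun k => by
    refine ⟨(s k).2, ?_⟩
    rw [hT, le_div_iff₀' hβ, Real.le_log_iff_exp_le (by linarith)]
    linarith [hexp k, hk1 k]
  obtain ⟨τ, hτ, g, hg, hgt⟩ := isCompact_Icc.tendsto_subseq hsT
  have hc : Tendsto (fun j => φ (s (g j)) x₀) atTop (𝓝 (φ τ x₀)) :=
    ((hφc τ hτ.1).tendsto).comp (tendsto_nhdsWithin_iff.2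
      ⟨hgt, Eventually.of_forall fun j => (hsT (g j)).1⟩)
  refine ⟨τ, hτ.1, ?_, ?_⟩
  · refine tendsto_nhds_unique hc ?_
    rw [tendsto_iff_dist_tendsto_zero]
    have hb : ∀ k : ℕ, 0 < k → dist (φ (s k) x₀) x ≤ (M * Real.exp (L * T)) * (k:ℝ)⁻¹ := by
      intro k hk
      set d := dist (φ (s k) x₀) x with hd
      have hd0 : 0 ≤ d := dist_nonneg
      have h1 : 1 + k * (Real.exp (-(L * T)) * d) ≤ M + 1 := by
        have e1 : 1 ≤ Real.exp (β * s k) := Real.one_le_exp (by positivity)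
        have e2 : Real.exp (-(L * T)) ≤ Real.exp (-(L * s k)) := by
          have := (hsT k).2
          gcongr
        have e3 : k * (Real.exp (-(L * T)) * d) ≤ k * (Real.exp (-(L * s k)) * d) := by gcongr
        have e4 : 0 ≤ k * (Real.exp (-(L * s k)) * d) := by positivity
        nlinarith [hs k, hk1 k]
      have hk' : (0:ℝ) < k := by exact_mod_cast hk
      rw [← div_eq_mul_inv, le_div_iff₀ hk', ← div_le_iff₀ (Real.exp_pos _), div_eq_mul_inv,
        ← Real.exp_neg]
      linarith
    have h0 : Tendsto (fun k : ℕ => (M * Real.exp (L * T)) * (k:ℝ)⁻¹) atTop (𝓝 0) := by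
      simpa using tendsto_inv_atTop_nhds_zero_nat.const_mul (M * Real.exp (L * T))
    have h1 : Tendsto (fun k : ℕ => dist (φ (s k) x₀) x) atTop (𝓝 0) :=
      squeeze_zero' (Eventually.of_forall fun _ => dist_nonneg)
        ((eventually_gt_atTop 0).mono hb) h0
    exact h1.comp hg.tendsto_atTop
  · have h1 : Tendsto (fun j => Real.exp (β * s (g j))) atTop (𝓝 (Real.exp (β * τ))) :=
      ((Real.continuous_exp.comp (continuous_const.mul continuous_id)).tendsto τ).comp hgt
    have h2 : Tendsto (fun j => M + 1 / ((g j:ℝ) + 1)) atTop (𝓝 (M + 0)) :=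
      tendsto_const_nhds.add (tendsto_one_div_add_atTop_nhds_zero_nat.comp hg.tendsto_atTop)
    rw [add_zero] at h2
    exact le_of_tendsto_of_tendsto' h1 h2 fun j => hexp (g j)
end



/-- Countably many Diracs case of the superposition theorem: if `(δ_{x₀}, Σᵢ aᵢ δ_{xᵢ}, μ)`
solve the discounted Liouville equation, then each `xᵢ` lies on the forward orbit of `x₀`,
reached at a time `τᵢ ≥ 0`, and `Σᵢ aᵢ e^{β τᵢ} ≤ 1`. -/
theorem liouville_countable_diracs {n : ℕ}
    (f : (Fin n → ℝ) → (Fin n → ℝ)) (K : NNReal) (hf : LipschitzWith K f)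
    (φ : ℝ → (Fin n → ℝ) → (Fin n → ℝ))
    (hφ0 : ∀ x, φ 0 x = x)
    (hφ : ∀ x, ∀ t ∈ Ici (0:ℝ), HasDerivWithinAt (fun s => φ s x) (f (φ t x)) (Ici 0) t)
    (β : ℝ) (hβ : 0 < β)
    (μ : Measure (Fin n → ℝ)) [IsFiniteMeasure μ]
    (hμc : ∃ K' : Set (Fin n → ℝ), IsCompact K' ∧ μ K'ᶜ = 0)
    (x₀ : Fin n → ℝ) (xs : ℕ → Fin n → ℝ)
    (hxs : ∃ C : Set (Fin n → ℝ), IsCompact C ∧ ∀ i, xs i ∈ C)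
    (a : ℕ → ℝ) (ha : ∀ i, 0 < a i) (hsum : Summable a)
    (hLiouville : ∀ v : (Fin n → ℝ) → ℝ, ContDiff ℝ 1 v →
      ∑' i, a i * v (xs i) = v x₀ + ∫ x, (fderiv ℝ v x (f x) - β * v x) ∂μ) :
    ∃ τ : ℕ → ℝ, (∀ i, 0 ≤ τ i) ∧ (∀ i, φ (τ i) x₀ = xs i) ∧
      ∃ S : ℝ, HasSum (fun i => a i * Real.exp (β * τ i)) S ∧ S ≤ 1 := by

  obtain ⟨L, hL0, hLβ, hfL⟩ : ∃ L : NNReal, 0 < L ∧ β ≤ L ∧ LipschitzWith L f :=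
    ⟨max K ⟨β, hβ.le⟩, lt_max_of_lt_right hβ, by
      have : (⟨β, hβ.le⟩ : NNReal) ≤ max K ⟨β, hβ.le⟩ := le_max_right _ _
      exact_mod_cast this, hf.weaken (le_max_left _ _)⟩
  have hV : ∀ k, Summable (fun i => a i * auxV φ β L x₀ k (xs i)) ∧
      ∑' i, a i * auxV φ β L x₀ k (xs i) ≤ 1 := fun k => by
    have := aux_test f L hL0 hfL φ hφ0 hφ β μ x₀ xs hxs a ha hsum hLiouville
      (auxV φ β L x₀ k) k (auxV_lip φ β L x₀ hβ hLβ k)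
      (auxV_flow φ β x₀ hβ f L hfL hφ0 hφ k)
    exact ⟨this.1, this.2.trans (auxV_x0 φ β L x₀ hβ hφ0 k)⟩
  have hpos : ∀ k i, 0 ≤ a i * auxV φ β L x₀ k (xs i) := fun k i =>
    mul_nonneg (ha i).le (zero_le_one.trans (auxV_ge φ β L x₀ hβ k _))
  have hfin : ∀ k (s : Finset ℕ), ∑ i ∈ s, a i * auxV φ β L x₀ k (xs i) ≤ 1 := fun k s =>
    ((hV k).1.sum_le_tsum s fun i _ => hpos k i).trans (hV k).2
  have hbdd : ∀ i, BddAbove (range fun k => auxV φ β L x₀ k (xs i)) := fun i => by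
    refine ⟨1 / a i, ?_⟩
    rintro _ ⟨k, rfl⟩
    rw [le_div_iff₀' (ha i)]
    simpa using hfin k {i}
  have hlim := fun i => auxV_limit φ β L x₀ hβ (by exact_mod_cast hL0)
    (fun t ht => (hφ x₀ t ht).continuousWithinAt) (xs i) _ (fun k => le_ciSup (hbdd i) k)
  choose τ hτ0 hτx hτe using hlim
  have hle : ∀ s : Finset ℕ, ∑ i ∈ s, a i * Real.exp (β * τ i) ≤ 1 := by
    intro s
    have h1 : Tendsto (fun k => ∑ i ∈ s, a i * auxV φ β L x₀ k (xs i)) atTop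
        (𝓝 (∑ i ∈ s, a i * ⨆ k, auxV φ β L x₀ k (xs i))) :=
      tendsto_finsetSum _ fun i _ =>
        (tendsto_atTop_ciSup (auxV_mono φ β L x₀ hβ (xs i)) (hbdd i)).const_mul _
    refine le_trans (Finset.sum_le_sum fun i _ => ?_) (le_of_tendsto' h1 fun k => hfin k s)
    exact mul_le_mul_of_nonneg_left (hτe i) (ha i).le
  have hnn : ∀ i, 0 ≤ a i * Real.exp (β * τ i) := fun i =>
    mul_nonneg (ha i).le (Real.exp_pos _).le
  have hsm : Summable (fun i => a i * Real.exp (β * τ i)) := summable_of_sum_le hnn hle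
  exact ⟨τ, hτ0, hτx, _, hsm.hasSum, hsm.tsum_le_of_sum_le hle⟩
end
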